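/- Let X ⊂ ℝ be the attractor of a strongly separated self-conformal IFS, let s = dim_H X, and let μ be the normalized s-Hausdorff measure on X. Let α₀ be the μ-almost sure value of the average density A(x) (which exists). For α ∈ ℝ let Δ̲(α) = {x ∈ X : A̲(x) ≤ α}. Then for every α ≤ α₀ one has dim_H Δ̲(α) = f(α), and for every α ≥ α₀ one has dim_H Δ̲(α) = s. -/

import Mathlib

open MeasureTheory Metric Filter Set
open scoped ENNReal Topology NNReal

noncomputable section

/-- The average `(1/(-log t)) ∫_t^1 μ(B(x,ρ)) ρ^{-s-1} dρ`. -/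
def avgA (μ : Measure ℝ) (s x t : ℝ) : ℝ :=
  (1 / (-Real.log t)) * ∫ ρ in t..1, (μ (ball x ρ)).toReal * ρ ^ (-s - 1)

/-- The upper average density of `μ` at `x`. -/
def upperAvg (μ : Measure ℝ) (s x : ℝ) : ℝ := limsup (fun t => avgA μ s x t) (𝓝[>] 0)

/-- The lower average density of `μ` at `x`. -/
def lowerAvg (μ : Measure ℝ) (s x : ℝ) : ℝ := liminf (fun t => avgA μ s x t) (𝓝[>] 0)

/-- A family of maps `φ w` of `X`, indexed by words and compatible with concatenation, with
approximate contraction ratios `r w`, having uniformly bounded distortion, asymptotically vanishing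
distortion at small scales, and separated cylinders. -/
structure ConformalSystem {ι : Type} (X : Set ℝ) (φ : List ι → ℝ → ℝ) (r : List ι → ℝ) (C : ℝ) :
    Prop where
  one_le : 1 ≤ C
  diam_le : ∀ x ∈ X, ∀ y ∈ X, |x - y| ≤ C
  append : ∀ u w x, φ (u ++ w) x = φ u (φ w x)
  mapsTo : ∀ w, ∀ x ∈ X, φ w x ∈ X
  continuous : ∀ w, Continuous (φ w)
  ratio_pos : ∀ w, 0 < r w
  ratio_le_one : ∀ w, r w ≤ 1
  lower : ∀ w, ∀ x ∈ X, ∀ y ∈ X, r w * |x - y| ≤ C * |φ w x - φ w y|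
  upper : ∀ w, ∀ x ∈ X, ∀ y ∈ X, |φ w x - φ w y| ≤ C * r w * |x - y|
  ratio_append_le : ∀ u w, r (u ++ w) ≤ C * (r u * r w)
  le_ratio_append : ∀ u w, r u * r w ≤ C * r (u ++ w)
  local_similarity : ∀ η > 0, ∃ ρ > 0, ∀ w, ∀ y ∈ X, ∃ lam, r w ≤ C * lam ∧ lam ≤ C * r w ∧
    ∀ x ∈ X, ∀ z ∈ X, |x - y| < ρ → |z - y| < ρ →
      Real.exp (-η) * lam * |x - z| ≤ |φ w x - φ w z| ∧
        |φ w x - φ w z| ≤ Real.exp η * lam * |x - z|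
  gap : ∀ w, ∀ x ∈ φ w '' X, ∀ z ∈ X, z ∉ φ w '' X → r w ≤ C * |x - z|
  exists_cylinder : ∀ x ∈ X, ∀ t, 0 < t → t ≤ 1 → ∃ w, x ∈ φ w '' X ∧ r w ≤ t ∧ t ≤ C * r w

/-- The composition of the maps `g i` along a word. -/
def wordMap {ι : Type} (g : ι → ℝ → ℝ) : List ι → ℝ → ℝ
  | [] => id
  | i :: w => g i ∘ wordMap g w

lemma wordMap_append {ι : Type} (g : ι → ℝ → ℝ) (u w : List ι) (x : ℝ) :
    wordMap g (u ++ w) x = wordMap g u (wordMap g w x) := by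
  induction u with
  | nil => rfl
  | cons i u ih => simp [wordMap, ih]

lemma exists_mul_sub_eq_sub {f : ℝ → ℝ} (hf : Differentiable ℝ f) (x y : ℝ) :
    ∃ c ∈ uIcc x y, f x - f y = deriv f c * (x - y) := by
  rcases lt_trichotomy x y with h | h | h
  · obtain ⟨c, hc, e⟩ := exists_deriv_eq_slope f h hf.continuous.continuousOn hf.differentiableOn
    refine ⟨c, by rw [uIcc_of_le h.le]; exact Ioo_subset_Icc_self hc, ?_⟩
    rw [e]
    have : y - x ≠ 0 := (sub_pos.2 h).ne'
    field_simp
    ring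
  · exact ⟨x, by simp, by simp [h]⟩
  · obtain ⟨c, hc, e⟩ := exists_deriv_eq_slope f h hf.continuous.continuousOn hf.differentiableOn
    refine ⟨c, by rw [uIcc_of_ge h.le]; exact Ioo_subset_Icc_self hc, ?_⟩
    rw [e]
    have : x - y ≠ 0 := (sub_pos.2 h).ne'
    field_simp

lemma abs_log_sub_log_le {a b m : ℝ} (hm : 0 < m) (ha : m ≤ a) (hb : m ≤ b) :
    |Real.log a - Real.log b| ≤ |a - b| / m := by
  have key : ∀ a b : ℝ, m ≤ a → m ≤ b → Real.log a - Real.log b ≤ |a - b| / m := by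
    intro a b ha hb
    have hb0 : 0 < b := hm.trans_le hb
    have ha0 : 0 < a := hm.trans_le ha
    rw [← Real.log_div ha0.ne' hb0.ne']
    calc Real.log (a / b) ≤ a / b - 1 := Real.log_le_sub_one_of_pos (by positivity)
      _ = (a - b) / b := by field_simp
      _ ≤ |a - b| / b := by gcongr; exact le_abs_self _
      _ ≤ |a - b| / m := by gcongr
  rw [abs_le]
  constructor
  · have := key b a hb ha
    rw [abs_sub_comm] at this
    linarith
  · exact key a b ha hb

lemma exists_log_deriv_holder {ι : Type} [Fintype ι] (g : ι → ℝ → ℝ)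
    (hreg : ∀ i, ContDiff ℝ 1 (g i) ∧
      ∃ (ε K : ℝ≥0), 0 < ε ∧ HolderWith K ε (deriv (g i)))
    (hder : ∀ i x, deriv (g i) x ≠ 0) {R : ℝ} :
    ∃ ε > 0, ∃ K ≥ 0, ∀ i, ∀ x ∈ closedBall (0 : ℝ) R, ∀ y ∈ closedBall (0 : ℝ) R,
      |Real.log (|deriv (g i) x|) - Real.log (|deriv (g i) y|)| ≤ K * |x - y| ^ (ε : ℝ) := by
  choose hc e k he hk using hreg
  obtain ⟨ε, hε, hεi⟩ : ∃ ε : ℝ, 0 < ε ∧ ∀ i, ε ≤ e i := by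
    rcases isEmpty_or_nonempty ι with h | h
    · exact ⟨1, one_pos, fun i => h.elim i⟩
    · obtain ⟨i, hi⟩ := Finite.exists_min (fun i => (e i : ℝ))
      exact ⟨e i, he i, hi⟩
  have hone : ∀ i, ∃ K : ℝ, ∀ x ∈ closedBall (0 : ℝ) R, ∀ y ∈ closedBall (0 : ℝ) R,
      |Real.log (|deriv (g i) x|) - Real.log (|deriv (g i) y|)| ≤ K * |x - y| ^ (ε : ℝ) := by
    intro i
    have hcont : Continuous fun x => |deriv (g i) x| :=
      ((hc i).continuous_deriv le_rfl).abs
    rcases (closedBall (0 : ℝ) R).eq_empty_or_nonempty with h0 | h0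
    · exact ⟨0, fun x hx => by simp [h0] at hx⟩
    obtain ⟨x₁, hx₁, hmin⟩ := (isCompact_closedBall (0 : ℝ) R).exists_isMinOn h0 hcont.continuousOn
    set m := |deriv (g i) x₁|
    have hm : 0 < m := abs_pos.2 (hder i x₁)
    refine ⟨k i * (2 * R) ^ ((e i : ℝ) - ε) / m, fun x hx y hy => ?_⟩
    have hxy : |x - y| ≤ 2 * R := by
      rw [mem_closedBall, dist_zero_right, Real.norm_eq_abs] at hx hy
      calc |x - y| ≤ |x| + |y| := abs_sub _ _
        _ ≤ 2 * R := by linarith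
    have h1 := abs_log_sub_log_le hm (hmin hx) (hmin hy)
    have h2 := (hk i).dist_le x y
    rw [Real.dist_eq, Real.dist_eq] at h2
    have h3 : |x - y| ^ (e i : ℝ) = |x - y| ^ ((e i : ℝ) - ε) * |x - y| ^ ε := by
      rw [← Real.rpow_add_of_nonneg (abs_nonneg _) (by linarith [hεi i]) hε.le]
      congr 1; ring
    have h4 : |x - y| ^ ((e i : ℝ) - ε) ≤ (2 * R) ^ ((e i : ℝ) - ε) :=
      Real.rpow_le_rpow (abs_nonneg _) hxy (by linarith [hεi i])
    calc _ ≤ _ := h1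
      _ ≤ |deriv (g i) x - deriv (g i) y| / m := by
        gcongr ?_ / m; exact abs_abs_sub_abs_le _ _
      _ ≤ (k i * (|x - y| ^ ((e i : ℝ) - ε) * |x - y| ^ ε)) / m := by rw [← h3]; gcongr
      _ ≤ (k i * ((2 * R) ^ ((e i : ℝ) - ε) * |x - y| ^ ε)) / m := by gcongr
      _ = _ := by ring
  choose K hK using hone
  refine ⟨ε, hε, ∑ i, |K i|, Finset.sum_nonneg fun i _ => abs_nonneg _, fun i x hx y hy => ?_⟩
  refine (hK i x hx y hy).trans ?_
  gcongr
  exact (le_abs_self _).trans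
    (Finset.single_le_sum (f := fun i => |K i|) (fun j _ => abs_nonneg _) (Finset.mem_univ i))

section IFS

variable {ι : Type} {g : ι → ℝ → ℝ}

lemma wordMap_singleton (i : ι) : wordMap g [i] = g i := rfl

lemma differentiable_wordMap (hg : ∀ i, Differentiable ℝ (g i)) (w : List ι) :
    Differentiable ℝ (wordMap g w) := by
  induction w with
  | nil => exact differentiable_id
  | cons i w ih => exact (hg i).comp ih

lemma deriv_wordMap_append (hg : ∀ i, Differentiable ℝ (g i)) (u w : List ι) (x : ℝ) :
    deriv (wordMap g (u ++ w)) x =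
      deriv (wordMap g u) (wordMap g w x) * deriv (wordMap g w) x := by
  have : wordMap g (u ++ w) = wordMap g u ∘ wordMap g w := funext fun x => wordMap_append g u w x
  rw [this, deriv_comp _ (differentiable_wordMap hg u _) (differentiable_wordMap hg w _)]

lemma deriv_wordMap_ne_zero (hg : ∀ i, Differentiable ℝ (g i)) (hder : ∀ i x, deriv (g i) x ≠ 0)
    (w : List ι) (x : ℝ) : deriv (wordMap g w) x ≠ 0 := by
  induction w using List.reverseRecOn generalizing x with
  | nil => simp [wordMap]
  | append_singleton w i ih =>
    rw [deriv_wordMap_append hg]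
    exact mul_ne_zero (ih _) (hder i x)

lemma mapsTo_wordMap {B : Set ℝ} (hB : ∀ i, MapsTo (g i) B B) (w : List ι) :
    MapsTo (wordMap g w) B B := by
  induction w with
  | nil => exact mapsTo_id B
  | cons i w ih => exact (hB i).comp ih

lemma abs_deriv_wordMap_le {θ : ℝ} (hθ : 0 ≤ θ) (hg : ∀ i, Differentiable ℝ (g i))
    (hd : ∀ i x, |deriv (g i) x| ≤ θ) (w : List ι) (x : ℝ) :
    |deriv (wordMap g w) x| ≤ θ ^ w.length := by
  induction w using List.reverseRecOn generalizing x with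
  | nil => simp [wordMap]
  | append_singleton w i ih =>
    rw [deriv_wordMap_append hg, abs_mul, List.length_append, List.length_singleton, pow_succ]
    exact mul_le_mul (ih _) (hd i x) (abs_nonneg _) (by positivity)

lemma wordMap_distortion {B : Set ℝ} (hB : ∀ i, MapsTo (g i) B B)
    (hg : ∀ i, Differentiable ℝ (g i)) (hder : ∀ i x, deriv (g i) x ≠ 0) {θ : ℝ} (hθ0 : 0 ≤ θ)
    (hθ : θ < 1) (hL : ∀ i x y, |g i x - g i y| ≤ θ * |x - y|) {ε K : ℝ} (hε : 0 < ε) (hK0 : 0 ≤ K)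
    (hK : ∀ i, ∀ x ∈ B, ∀ y ∈ B,
      |Real.log (|deriv (g i) x|) - Real.log (|deriv (g i) y|)| ≤ K * |x - y| ^ ε)
    (w : List ι) : ∀ x ∈ B, ∀ y ∈ B,
      |Real.log (|deriv (wordMap g w) x|) - Real.log (|deriv (wordMap g w) y|)| ≤
        K / (1 - θ ^ ε) * |x - y| ^ ε := by
  have hθε : 0 < 1 - θ ^ ε := by
    have := Real.rpow_lt_one hθ0 hθ hε
    linarith
  induction w using List.reverseRecOn with
  | nil =>
    intro x _ y _
    simp only [wordMap, deriv_id, sub_self, abs_zero]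
    positivity
  | append_singleton w i ih =>
    intro x hx y hy
    have h := deriv_wordMap_ne_zero hg hder w
    rw [deriv_wordMap_append hg, deriv_wordMap_append hg, abs_mul, abs_mul, wordMap_singleton,
      Real.log_mul (abs_ne_zero.2 (h _)) (abs_ne_zero.2 (hder i x)),
      Real.log_mul (abs_ne_zero.2 (h _)) (abs_ne_zero.2 (hder i y))]
    have h1 := ih (g i x) (hB i hx) (g i y) (hB i hy)
    have h2 := hK i x hx y hy
    have h3 : |g i x - g i y| ^ ε ≤ θ ^ ε * |x - y| ^ ε := by
      rw [← Real.mul_rpow hθ0 (abs_nonneg _)]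
      exact Real.rpow_le_rpow (abs_nonneg _) (hL i x y) hε.le
    have h4 : K / (1 - θ ^ ε) * |g i x - g i y| ^ ε ≤
        K / (1 - θ ^ ε) * (θ ^ ε * |x - y| ^ ε) := by gcongr
    have h5 : K / (1 - θ ^ ε) * (θ ^ ε * |x - y| ^ ε) + K * |x - y| ^ ε =
        K / (1 - θ ^ ε) * |x - y| ^ ε := by
      field_simp
      ring
    rw [abs_le] at h1 h2 ⊢
    constructor <;> linarith [h1.1, h1.2, h2.1, h2.2]

lemma exists_uniform_contraction [Fintype ι]
    (hcontr : ∀ i, ∃ L : ℝ≥0, L < 1 ∧ LipschitzWith L (g i)) :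
    ∃ θ : ℝ, 0 ≤ θ ∧ θ < 1 ∧ (∀ i x y, |g i x - g i y| ≤ θ * |x - y|) ∧
      ∀ i x, |deriv (g i) x| ≤ θ := by
  choose L hL hLip using hcontr
  obtain ⟨θ, hθ, hθi⟩ : ∃ θ : ℝ≥0, θ < 1 ∧ ∀ i, L i ≤ θ := by
    rcases isEmpty_or_nonempty ι with h | h
    · exact ⟨0, one_pos, fun i => h.elim i⟩
    · obtain ⟨i, hi⟩ := Finite.exists_max L
      exact ⟨L i, hL i, hi⟩
  refine ⟨θ, θ.2, hθ, fun i x y => ?_, fun i x => ?_⟩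
  · exact ((hLip i).weaken (hθi i)).dist_le_mul x y
  · exact norm_deriv_le_of_lipschitz ((hLip i).weaken (hθi i))

lemma exists_invariant_closedBall [Fintype ι] {θ : ℝ} (hθ : θ < 1)
    (hL : ∀ i x y, |g i x - g i y| ≤ θ * |x - y|) {X : Set ℝ} (hX : IsCompact X) (hθ0 : 0 ≤ θ) :
    ∃ R : ℝ, 0 ≤ R ∧ X ⊆ closedBall 0 R ∧ ∀ i, MapsTo (g i) (closedBall 0 R) (closedBall 0 R) := by
  obtain ⟨R₀, hR₀⟩ := hX.isBounded.subset_closedBall (0 : ℝ)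
  have h1 : 0 < 1 - θ := by linarith
  set S := ∑ i, |g i 0| / (1 - θ)
  have hS : 0 ≤ S := Finset.sum_nonneg fun i _ => by positivity
  have hR : |R₀| ≤ |R₀| + S := by linarith
  refine ⟨|R₀| + S, by positivity,
    hR₀.trans (closedBall_subset_closedBall ((le_abs_self _).trans hR)), fun i x hx => ?_⟩
  rw [mem_closedBall, dist_zero_right, Real.norm_eq_abs] at hx ⊢
  have h2 : |g i 0| / (1 - θ) ≤ S :=
    Finset.single_le_sum (f := fun i => |g i 0| / (1 - θ)) (fun j _ => by positivity)
      (Finset.mem_univ i)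
  rw [div_le_iff₀ h1] at h2
  have h3 := hL i x 0
  rw [sub_zero] at h3
  have h4 : |g i x| ≤ |g i x - g i 0| + |g i 0| := by
    have := abs_add_le (g i x - g i 0) (g i 0)
    simpa using this
  have h5 : θ * |x| ≤ θ * (|R₀| + S) := by gcongr
  nlinarith [abs_nonneg R₀]

lemma exists_separation_const [Fintype ι] (hg : ∀ i, Continuous (g i)) {X : Set ℝ}
    (hX : IsCompact X) (hsep : Pairwise fun i j => Disjoint (g i '' X) (g j '' X)) :
    ∃ δ > 0, ∀ i j, i ≠ j → ∀ x ∈ g i '' X, ∀ y ∈ g j '' X, δ ≤ |x - y| := by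
  have h : ∀ p : ι × ι, ∃ δ > 0, p.1 ≠ p.2 → ∀ x ∈ g p.1 '' X, ∀ y ∈ g p.2 '' X,
      (δ : ℝ) ≤ |x - y| := by
    rintro ⟨i, j⟩
    by_cases hij : i = j
    · exact ⟨1, one_pos, fun h => (h hij).elim⟩
    · obtain ⟨δ, hδ, h⟩ := exists_pos_forall_lt_edist (hX.image (hg i))
        (hX.image (hg j)).isClosed (hsep hij)
      refine ⟨δ, hδ, fun _ x hx y hy => ?_⟩
      have := h x hx y hy
      rw [edist_nndist, ENNReal.coe_lt_coe] at this
      exact (NNReal.coe_lt_coe.2 this).le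
  choose δ hδ h using h
  rcases isEmpty_or_nonempty ι with h0 | h0
  · exact ⟨1, one_pos, fun i => h0.elim i⟩
  · obtain ⟨p, hp⟩ := Finite.exists_min δ
    exact ⟨δ p, hδ p, fun i j hij x hx y hy => (hp (i, j)).trans (h (i, j) hij x hx y hy)⟩

lemma exists_common_prefix {X : Set ℝ} (hXinv : X = ⋃ i, g i '' X) (w : List ι) :
    ∀ x ∈ wordMap g w '' X, ∀ z ∈ X, z ∉ wordMap g w '' X →
      ∃ v u i j, w = v ++ u ∧ i ≠ j ∧ ∃ x' ∈ g i '' X, ∃ z' ∈ g j '' X,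
        x = wordMap g v x' ∧ z = wordMap g v z' := by
  induction w with
  | nil => intro x _ z hz hzn; simp [wordMap] at hzn; exact (hzn hz).elim
  | cons i w ih =>
    rintro x ⟨p, hp, rfl⟩ z hz hzn
    have hmaps : MapsTo (wordMap g w) X X := mapsTo_wordMap (fun i y hy => by
      rw [hXinv]; exact mem_iUnion.2 ⟨i, mem_image_of_mem _ hy⟩) w
    have hz' := hz
    rw [hXinv] at hz'
    obtain ⟨j, q, hq, rfl⟩ := mem_iUnion.1 hz'
    by_cases hij : i = j
    · subst hij
      have : q ∉ wordMap g w '' X := fun ⟨y, hy, e⟩ => hzn ⟨y, hy, by simp [wordMap, e]⟩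
      obtain ⟨v, u, k, l, e, hkl, x', hx', z', hz', e1, e2⟩ :=
        ih _ (mem_image_of_mem _ hp) q hq this
      refine ⟨i :: v, u, k, l, by simp [e], hkl, x', hx', z', hz', ?_, ?_⟩
      · simp [wordMap, e1]
      · simp [wordMap, e2]
    · exact ⟨[], i :: w, i, j, rfl, hij, _, ⟨_, hmaps hp, rfl⟩, _, ⟨q, hq, rfl⟩, rfl, rfl⟩

lemma exists_word_ratio {X : Set ℝ} (hXinv : X = ⋃ i, g i '' X) {r : List ι → ℝ} {b θ : ℝ}
    (h1 : r [] = 1) (hb : b ≤ 1) (hr : ∀ w i, b * r w ≤ r (w ++ [i]))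
    (hrw : ∀ w, r w ≤ θ ^ w.length)
    (hθ : θ < 1) {x : ℝ} (hx : x ∈ X) {t : ℝ} (ht : 0 < t) (ht1 : t ≤ 1) (hb0 : 0 ≤ b) :
    ∃ w, x ∈ wordMap g w '' X ∧ r w ≤ t ∧ b * t ≤ r w := by
  have key : ∀ n : ℕ, (∃ w, x ∈ wordMap g w '' X ∧ r w ≤ t ∧ b * t ≤ r w) ∨
      ∃ w, w.length = n ∧ x ∈ wordMap g w '' X ∧ t < r w := by
    intro n
    induction n with
    | zero =>
      by_cases h : t = 1
      · exact Or.inl ⟨[], ⟨x, hx, rfl⟩, by rw [h1, h], by rw [h1, h]; linarith⟩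
      · exact Or.inr ⟨[], rfl, ⟨x, hx, rfl⟩, by rw [h1]; exact lt_of_le_of_ne ht1 h⟩
    | succ n ih =>
      rcases ih with h | ⟨w, hw, ⟨y, hy, e⟩, hlt⟩
      · exact Or.inl h
      · rw [hXinv] at hy
        obtain ⟨i, z, hz, rfl⟩ := mem_iUnion.1 hy
        have hmem : x ∈ wordMap g (w ++ [i]) '' X := ⟨z, hz, by
          rw [wordMap_append, wordMap_singleton, e]⟩
        rcases le_or_gt (r (w ++ [i])) t with h | h
        · refine Or.inl ⟨_, hmem, h, le_trans ?_ (hr w i)⟩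
          gcongr
        · exact Or.inr ⟨_, by simp [hw], hmem, h⟩
  obtain ⟨n, hn⟩ := exists_pow_lt_of_lt_one ht hθ
  rcases key n with h | ⟨w, hw, -, hlt⟩
  · exact h
  · have := hrw w
    rw [hw] at this
    linarith

end IFS

lemma abs_le_exp_mul_abs {a b D : ℝ} (ha : a ≠ 0) (hb : b ≠ 0)
    (h : |Real.log (|a|) - Real.log (|b|)| ≤ D) : |a| ≤ Real.exp D * |b| := by
  have h1 : Real.log (|a|) ≤ D + Real.log (|b|) := by linarith [(abs_le.1 h).2]
  calc |a| = Real.exp (Real.log (|a|)) := (Real.exp_log (abs_pos.2 ha)).symm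
    _ ≤ Real.exp (D + Real.log (|b|)) := Real.exp_le_exp.2 h1
    _ = _ := by rw [Real.exp_add, Real.exp_log (abs_pos.2 hb)]

theorem exists_conformalSystem {ι : Type} [Fintype ι] (g : ι → ℝ → ℝ)
    (hreg : ∀ i, ContDiff ℝ 1 (g i) ∧
      ∃ (ε K : ℝ≥0), 0 < ε ∧ HolderWith K ε (deriv (g i)))
    (hcontr : ∀ i, ∃ L : ℝ≥0, L < 1 ∧ LipschitzWith L (g i))
    (hder : ∀ i x, deriv (g i) x ≠ 0)
    {X : Set ℝ} (hXc : IsCompact X) (hXne : X.Nonempty)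
    (hXinv : X = ⋃ i, g i '' X)
    (hsep : Pairwise fun i j => Disjoint (g i '' X) (g j '' X)) :
    ∃ φ r C, ConformalSystem (ι := ι) X φ r C := by
  have hg : ∀ i, Differentiable ℝ (g i) := fun i => (hreg i).1.differentiable one_ne_zero
  obtain ⟨x₀, hx₀⟩ := hXne
  obtain ⟨θ, hθ0, hθ1, hL, hd⟩ := exists_uniform_contraction hcontr
  obtain ⟨R, hR0, hXB, hB⟩ := exists_invariant_closedBall hθ1 hL hXc hθ0
  obtain ⟨ε, hε, K, hK0, hK⟩ := exists_log_deriv_holder g hreg hder (R := R)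
  obtain ⟨δ, hδ, hδsep⟩ := exists_separation_const (fun i => (hg i).continuous) hXc hsep
  set B := closedBall (0 : ℝ) R
  set φ := wordMap g
  set r : List ι → ℝ := fun w => |deriv (φ w) x₀| with hr
  set K' := K / (1 - θ ^ ε)
  have hK'0 : 0 ≤ K' := by
    have := Real.rpow_lt_one hθ0 hθ1 hε
    exact div_nonneg hK0 (by linarith)
  have hdist : ∀ w, ∀ x ∈ B, ∀ y ∈ B,
      |Real.log (|deriv (φ w) x|) - Real.log (|deriv (φ w) y|)| ≤ K' * |x - y| ^ ε :=
    wordMap_distortion hB hg hder hθ0 hθ1 hL hε hK0 hK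
  have hne : ∀ w x, deriv (φ w) x ≠ 0 := deriv_wordMap_ne_zero hg hder
  have hdiff : ∀ w, Differentiable ℝ (φ w) := differentiable_wordMap hg
  have hdiam : ∀ x ∈ B, ∀ y ∈ B, |x - y| ≤ 2 * R := by
    intro x hx y hy
    rw [mem_closedBall, dist_zero_right, Real.norm_eq_abs] at hx hy
    calc |x - y| ≤ |x| + |y| := abs_sub _ _
      _ ≤ 2 * R := by linarith
  set D := K' * (2 * R) ^ ε
  have hD0 : 0 ≤ D := by positivity
  have hbd : ∀ w, ∀ x ∈ B, ∀ y ∈ B, |deriv (φ w) x| ≤ Real.exp D * |deriv (φ w) y| := by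
    intro w x hx y hy
    refine abs_le_exp_mul_abs (hne w x) (hne w y) ((hdist w x hx y hy).trans ?_)
    exact mul_le_mul_of_nonneg_left (Real.rpow_le_rpow (abs_nonneg _) (hdiam x hx y hy) hε.le) hK'0
  have hXX : ∀ i, MapsTo (g i) X X := fun i y hy => by
    rw [hXinv]; exact mem_iUnion.2 ⟨i, mem_image_of_mem _ hy⟩
  have hφX : ∀ w, MapsTo (φ w) X X := mapsTo_wordMap hXX
  have hrpos : ∀ w, 0 < r w := fun w => abs_pos.2 (hne w x₀)
  have hrpow : ∀ w, r w ≤ θ ^ w.length := fun w => abs_deriv_wordMap_le hθ0 hg hd w x₀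
  have hrone : ∀ w, r w ≤ 1 := fun w => (hrpow w).trans (pow_le_one₀ hθ0 hθ1.le)
  have hrapp : ∀ u w, r (u ++ w) = |deriv (φ u) (φ w x₀)| * r w := fun u w => by
    simp only [hr, φ]; rw [deriv_wordMap_append hg, abs_mul]
  have hle : ∀ u w, r (u ++ w) ≤ Real.exp D * (r u * r w) := fun u w => by
    rw [hrapp, ← mul_assoc]
    exact mul_le_mul_of_nonneg_right (hbd u _ (hXB (hφX w hx₀)) _ (hXB hx₀)) (hrpos w).le
  have hge : ∀ u w, r u * r w ≤ Real.exp D * r (u ++ w) := fun u w => by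
    rw [hrapp, ← mul_assoc]
    exact mul_le_mul_of_nonneg_right (hbd u _ (hXB hx₀) _ (hXB (hφX w hx₀))) (hrpos w).le
  have hseg : ∀ x ∈ B, ∀ y ∈ B, uIcc x y ⊆ B := fun x hx y hy => by
    rw [← segment_eq_uIcc]; exact (convex_closedBall (0 : ℝ) R).segment_subset hx hy
  have hlow : ∀ w, ∀ x ∈ X, ∀ y ∈ X, r w * |x - y| ≤ Real.exp D * |φ w x - φ w y| := by
    intro w x hx y hy
    obtain ⟨c, hc, e⟩ := exists_mul_sub_eq_sub (hdiff w) x y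
    rw [e, abs_mul, ← mul_assoc]
    exact mul_le_mul_of_nonneg_right
      (hbd w _ (hXB hx₀) _ (hseg x (hXB hx) y (hXB hy) hc)) (abs_nonneg _)
  have hup : ∀ w, ∀ x ∈ X, ∀ y ∈ X, |φ w x - φ w y| ≤ Real.exp D * r w * |x - y| := by
    intro w x hx y hy
    obtain ⟨c, hc, e⟩ := exists_mul_sub_eq_sub (hdiff w) x y
    rw [e, abs_mul]
    exact mul_le_mul_of_nonneg_right
      (hbd w _ (hseg x (hXB hx) y (hXB hy) hc) _ (hXB hx₀)) (abs_nonneg _)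
  obtain ⟨b, hb, hb1, hbr⟩ : ∃ b > 0, b ≤ 1 ∧ ∀ w i, b * r w ≤ r (w ++ [i]) := by
    obtain ⟨a, ha, hai⟩ : ∃ a > 0, ∀ i, a ≤ |deriv (g i) x₀| := by
      rcases isEmpty_or_nonempty ι with h0 | h0
      · exact ⟨1, one_pos, fun i => h0.elim i⟩
      · obtain ⟨i, hi⟩ := Finite.exists_min fun i => |deriv (g i) x₀|
        exact ⟨_, abs_pos.2 (hder i x₀), hi⟩
    refine ⟨min 1 (Real.exp (-D) * a), lt_min one_pos (by positivity), min_le_left _ _,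
      fun w i => ?_⟩
    have h1 := hge w [i]
    have h2 : r w * a ≤ r w * r [i] := mul_le_mul_of_nonneg_left (hai i) (hrpos w).le
    calc min 1 (Real.exp (-D) * a) * r w ≤ (Real.exp (-D) * a) * r w :=
          mul_le_mul_of_nonneg_right (min_le_right _ _) (hrpos w).le
      _ = Real.exp (-D) * (r w * a) := by ring
      _ ≤ Real.exp (-D) * (Real.exp D * r (w ++ [i])) :=
          mul_le_mul_of_nonneg_left (h2.trans h1) (Real.exp_pos _).le
      _ = r (w ++ [i]) := by rw [← mul_assoc, ← Real.exp_add]; simp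
  set C := 1 + 2 * R + Real.exp D + Real.exp D * Real.exp D / δ + 1 / b
  have c1 : 0 < Real.exp D := Real.exp_pos D
  have c2 : 0 ≤ Real.exp D * Real.exp D / δ := by positivity
  have c3 : 0 ≤ 1 / b := by positivity
  have hC1 : Real.exp D ≤ C := by simp only [C]; linarith
  have hC2 : Real.exp D * Real.exp D / δ ≤ C := by simp only [C]; linarith
  have hC3 : 1 / b ≤ C := by simp only [C]; linarith
  refine ⟨φ, r, C, ?_⟩
  constructor
  · simp only [C]; linarith
  · intro x hx y hy
    have := hdiam x (hXB hx) y (hXB hy)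
    simp only [C]; linarith
  · exact wordMap_append g
  · exact hφX
  · exact fun w => (hdiff w).continuous
  · exact hrpos
  · exact hrone
  · intro w x hx y hy
    exact (hlow w x hx y hy).trans (mul_le_mul_of_nonneg_right hC1 (abs_nonneg _))
  · intro w x hx y hy
    refine (hup w x hx y hy).trans ?_
    gcongr
  · intro u w
    exact (hle u w).trans
      (mul_le_mul_of_nonneg_right hC1 (mul_pos (hrpos u) (hrpos w)).le)
  · intro u w
    exact (hge u w).trans (mul_le_mul_of_nonneg_right hC1 (hrpos _).le)
  · intro η hη
    obtain ⟨ρ, hρ, hρη⟩ : ∃ ρ > 0, K' * ρ ^ ε ≤ η := by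
      refine ⟨(η / (K' + 1)) ^ (1 / ε), by positivity, ?_⟩
      rw [← Real.rpow_mul (by positivity), one_div_mul_cancel hε.ne', Real.rpow_one]
      have : K' * (η / (K' + 1)) = K' / (K' + 1) * η := by ring
      rw [this]
      have : K' / (K' + 1) ≤ 1 := by rw [div_le_one (by positivity)]; linarith
      nlinarith
    refine ⟨ρ, hρ, fun w y hy => ⟨|deriv (φ w) y|, ?_, ?_, fun x hx z hz hxy hzy => ?_⟩⟩
    · exact (hbd w _ (hXB hx₀) _ (hXB hy)).trans
        (mul_le_mul_of_nonneg_right hC1 (abs_nonneg _))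
    · exact (hbd w _ (hXB hy) _ (hXB hx₀)).trans
        (mul_le_mul_of_nonneg_right hC1 (abs_nonneg _))
    · obtain ⟨c, hc, e⟩ := exists_mul_sub_eq_sub (hdiff w) x z
      have hcB := hseg x (hXB hx) z (hXB hz) hc
      have hcy : |c - y| < ρ := by
        have : uIcc x z ⊆ ball y ρ := by
          rw [← segment_eq_uIcc]
          exact (convex_ball y ρ).segment_subset (by simpa [Real.dist_eq] using hxy)
            (by simpa [Real.dist_eq] using hzy)
        simpa [Real.dist_eq] using this hc
      have h1 : K' * |c - y| ^ ε ≤ η := by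
        refine le_trans ?_ hρη
        gcongr
      have h2 := (hdist w c hcB y (hXB hy)).trans h1
      rw [e, abs_mul]
      constructor
      · refine mul_le_mul_of_nonneg_right ?_ (abs_nonneg _)
        rw [abs_sub_comm] at h2
        have := abs_le_exp_mul_abs (hne w y) (hne w c) h2
        rw [Real.exp_neg, inv_mul_le_iff₀ (Real.exp_pos η)]
        exact this
      · exact mul_le_mul_of_nonneg_right (abs_le_exp_mul_abs (hne w c) (hne w y) h2)
          (abs_nonneg _)
  · intro w x hx z hz hzn
    obtain ⟨v, u, i, j, rfl, hij, x', hx', z', hz', rfl, rfl⟩ :=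
      exists_common_prefix hXinv w x hx z hz hzn
    have h1 := hδsep i j hij x' hx' z' hz'
    have hx'X : x' ∈ X := by rw [hXinv]; exact mem_iUnion.2 ⟨i, hx'⟩
    have hz'X : z' ∈ X := by rw [hXinv]; exact mem_iUnion.2 ⟨j, hz'⟩
    have h2 := hlow v x' hx'X z' hz'X
    have h3 : r (v ++ u) ≤ Real.exp D * r v := by
      refine (hle v u).trans (mul_le_mul_of_nonneg_left ?_ (Real.exp_pos D).le)
      exact mul_le_of_le_one_right (hrpos v).le (hrone u)
    refine le_trans ?_ (mul_le_mul_of_nonneg_right hC2 (abs_nonneg _))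
    rw [div_mul_eq_mul_div, le_div_iff₀ hδ]
    have h4 : r v * δ ≤ r v * |x' - z'| := mul_le_mul_of_nonneg_left h1 (hrpos v).le
    calc r (v ++ u) * δ ≤ Real.exp D * r v * δ := mul_le_mul_of_nonneg_right h3 hδ.le
      _ = Real.exp D * (r v * δ) := by ring
      _ ≤ Real.exp D * (Real.exp D * |φ v x' - φ v z'|) :=
        mul_le_mul_of_nonneg_left (h4.trans h2) (Real.exp_pos D).le
      _ = _ := by ring
  · intro x hx t ht ht1
    have hnil : r [] = 1 := by simp [hr, φ, wordMap]
    obtain ⟨w, hw, h1, h2⟩ := exists_word_ratio hXinv hnil hb1 hbr hrpow hθ1 hx ht ht1 hb.le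
    refine ⟨w, hw, h1, le_trans ?_ (mul_le_mul_of_nonneg_right hC3 (hrpos w).le)⟩
    rw [div_mul_eq_mul_div, one_mul, le_div_iff₀ hb]
    linarith

lemma ofReal_le_dimH_of_inverse_holder {E : Set ℝ} {f : ℝ → ℝ} {A e : ℝ} (hA : 0 ≤ A) (he : 0 < e)
    (hfE : ∀ y ∈ Ico (0 : ℝ) 1, f y ∈ E)
    (hf : ∀ y ∈ Ico (0 : ℝ) 1, ∀ y' ∈ Ico (0 : ℝ) 1, y ≠ y' → |y - y'| ≤ A * |f y - f y'| ^ e) :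
    ENNReal.ofReal e ≤ dimH E := by
  have hinj : InjOn f (Ico 0 1) := by
    intro y hy y' hy' h
    by_contra hne
    have := hf y hy y' hy' hne
    rw [h, sub_self, abs_zero, Real.zero_rpow he.ne', mul_zero] at this
    exact hne (sub_eq_zero.1 (abs_nonpos_iff.1 this))
  have hleft := hinj.leftInvOn_invFunOn
  have hhol : HolderOnWith A.toNNReal e.toNNReal (Function.invFunOn f (Ico 0 1))
      (f '' Ico 0 1) := by
    rintro _ ⟨y, hy, rfl⟩ _ ⟨y', hy', rfl⟩
    rw [hleft hy, hleft hy']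
    by_cases h : y = y'
    · simp [h]
    · have := hf y hy y' hy' h
      rw [edist_dist, edist_dist, Real.dist_eq, Real.dist_eq, Real.coe_toNNReal _ he.le,
        ENNReal.ofReal_rpow_of_nonneg (abs_nonneg _) he.le, ← ENNReal.ofReal_coe_nnreal,
        Real.coe_toNNReal _ hA, ← ENNReal.ofReal_mul hA]
      exact ENNReal.ofReal_le_ofReal this
  have h1 := hhol.dimH_image_le (Real.toNNReal_pos.2 he)
  have h2 : Function.invFunOn f (Ico 0 1) '' (f '' Ico 0 1) = Ico 0 1 := hleft.image_image
  rw [h2, Real.dimH_of_nonempty_interior (by simp), Module.finrank_self, Nat.cast_one] at h1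
  have h3 : (1 : ℝ≥0∞) * (e.toNNReal : ℝ≥0∞) ≤ dimH (f '' Ico 0 1) :=
    (ENNReal.le_div_iff_mul_le (Or.inl (by simpa using he)) (Or.inl ENNReal.coe_ne_top)).1 h1
  rw [one_mul] at h3
  exact h3.trans (dimH_mono (image_subset_iff.2 hfE))

/-- The state after `k` steps of the mixed-radix expansion of `y`: the remaining fractional part and
the word chosen by following the digits. -/
def radixWalk {ι : Type} (N : ℕ → ℕ) (child : ℕ → List ι → ℕ → List ι) (y : ℝ) :
    ℕ → ℝ × List ι
  | 0 => (y, [])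
  | k + 1 =>
    let p := radixWalk N child y k
    (Int.fract (N k * p.1), p.2 ++ child k p.2 ⌊N k * p.1⌋₊)

section Walk

variable {ι : Type} {N : ℕ → ℕ} {child : ℕ → List ι → ℕ → List ι}

lemma radixWalk_mem {y : ℝ} (hy : y ∈ Ico (0 : ℝ) 1) (k : ℕ) :
    (radixWalk N child y k).1 ∈ Ico (0 : ℝ) 1 := by
  cases k with
  | zero => exact hy
  | succ k => exact ⟨Int.fract_nonneg _, Int.fract_lt_one _⟩

lemma radixWalk_digit_lt (hN : ∀ k, 0 < N k) {y : ℝ} (hy : y ∈ Ico (0 : ℝ) 1) (k : ℕ) :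
    ⌊N k * (radixWalk N child y k).1⌋₊ < N k := by
  obtain ⟨h0, h1⟩ := radixWalk_mem (N := N) (child := child) hy k
  have hk : (0 : ℝ) < N k := by exact_mod_cast hN k
  rw [Nat.floor_lt (by positivity)]
  nlinarith

lemma radixWalk_agree {y y' : ℝ} (hy : y ∈ Ico (0 : ℝ) 1) (hy' : y' ∈ Ico (0 : ℝ) 1) (k : ℕ)
    (h : ∀ i < k, ⌊N i * (radixWalk N child y i).1⌋₊ = ⌊N i * (radixWalk N child y' i).1⌋₊) :
    (radixWalk N child y k).2 = (radixWalk N child y' k).2 ∧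
      (∏ i ∈ Finset.range k, (N i : ℝ)) * (y - y') =
        (radixWalk N child y k).1 - (radixWalk N child y' k).1 := by
  induction k with
  | zero => simp [radixWalk]
  | succ k ih =>
    obtain ⟨h1, h2⟩ := ih fun i hi => h i (hi.trans k.lt_succ_self)
    have h3 := h k k.lt_succ_self
    refine ⟨by simp only [radixWalk]; rw [h3, h1], ?_⟩
    rw [Finset.prod_range_succ]
    simp only [radixWalk]
    have h4 : ⌊N k * (radixWalk N child y k).1⌋ = ⌊N k * (radixWalk N child y' k).1⌋ := by
      rw [← Int.natCast_floor_eq_floor, ← Int.natCast_floor_eq_floor, h3]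
      · exact mul_nonneg (Nat.cast_nonneg _) (radixWalk_mem hy' k).1
      · exact mul_nonneg (Nat.cast_nonneg _) (radixWalk_mem hy k).1
    rw [← Int.self_sub_floor, ← Int.self_sub_floor, h4]
    linear_combination (N k : ℝ) * h2

lemma ratio_radixWalk_ge {r : List ι → ℝ} {m : ℕ → ℝ} (hN : ∀ k, 0 < N k)
    (hr : ∀ k u i, i < N k → r u * Real.exp (-m k) ≤ r (u ++ child k u i))
    {y : ℝ} (hy : y ∈ Ico (0 : ℝ) 1) (k : ℕ) :
    r [] * Real.exp (-∑ i ∈ Finset.range k, m i) ≤ r (radixWalk N child y k).2 := by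
  induction k with
  | zero => simp [radixWalk]
  | succ k ih =>
    refine le_trans ?_ (hr k _ _ (radixWalk_digit_lt hN hy k))
    rw [Finset.sum_range_succ, neg_add, Real.exp_add, ← mul_assoc]
    exact mul_le_mul_of_nonneg_right ih (Real.exp_pos _).le

end Walk

/-- Lower bound for the dimension of a Moran set inside the attractor: at step `k` a cylinder `u`
has `N k ≥ exp (d * m k)` subcylinders, of ratio at least `exp (-m k)` relative to `u` and separated
accordingly. -/
theorem ConformalSystem.le_dimH_moran {ι : Type} {X : Set ℝ} {φ : List ι → ℝ → ℝ} {r : List ι → ℝ}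
    {C : ℝ} (h : ConformalSystem X φ r C) (hXc : IsCompact X) (hXne : X.Nonempty)
    {N : ℕ → ℕ} {m : ℕ → ℝ} {child : ℕ → List ι → ℕ → List ι} {d e K K' : ℝ} (he : 0 < e)
    (hK : 0 < K) (hN2 : ∀ k, 2 ≤ N k) (hN : ∀ k, Real.exp (d * m k) ≤ N k)
    (hr : ∀ k u i, i < N k → r u * Real.exp (-m k) ≤ r (u ++ child k u i))
    (hsep : ∀ k u i j, i < N k → j < N k → i ≠ j → ∀ x ∈ φ (u ++ child k u i) '' X,
      ∀ y ∈ φ (u ++ child k u j) '' X, r u * Real.exp (-m k) ≤ K * |x - y|)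
    (hgrow : ∀ k, e * (∑ i ∈ Finset.range k, m i + m k) ≤ d * ∑ i ∈ Finset.range k, m i + K') :
    ENNReal.ofReal e ≤ dimH {x ∈ X | ∃ u : ℕ → List ι, u 0 = [] ∧
      (∀ k, ∃ i < N k, u (k + 1) = u k ++ child k (u k) i) ∧ ∀ k, x ∈ φ (u k) '' X} := by
  have hN0 : ∀ k, 0 < N k := fun k => zero_lt_two.trans_le (hN2 k)
  have hex : ∀ y : ℝ, ∃ x, ∀ k, x ∈ φ (radixWalk N child y k).2 '' X := by
    intro y
    have := IsCompact.nonempty_iInter_of_sequence_nonempty_isCompact_isClosed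
      (fun k => φ (radixWalk N child y k).2 '' X) ?_ (fun k => hXne.image _)
      (hXc.image (h.continuous _)) (fun k => (hXc.image (h.continuous _)).isClosed)
    · obtain ⟨x, hx⟩ := this
      exact ⟨x, fun k => mem_iInter.1 hx k⟩
    · rintro k _ ⟨z, hz, rfl⟩
      simp only [radixWalk]
      exact ⟨_, h.mapsTo _ z hz, (h.append _ _ _).symm⟩
  choose f hf using hex
  have hfX : ∀ y, f y ∈ X := fun y => by
    obtain ⟨z, hz, e⟩ := hf y 0
    rw [← e]; exact h.mapsTo _ z hz
  have hr0 := h.ratio_pos []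
  refine ofReal_le_dimH_of_inverse_holder (f := f) (A := Real.exp K' * (K / r []) ^ e)
    (by positivity) he (fun y hy => ⟨hfX y, fun k => (radixWalk N child y k).2, rfl,
      fun k => ⟨_, radixWalk_digit_lt hN0 hy k, rfl⟩, hf y⟩) fun y hy y' hy' hne => ?_
  have hdiff : ∃ k, ⌊N k * (radixWalk N child y k).1⌋₊ ≠ ⌊N k * (radixWalk N child y' k).1⌋₊ := by
    by_contra! hall
    have hpos : 0 < |y - y'| := abs_pos.2 (sub_ne_zero.2 hne)
    obtain ⟨k, hk⟩ := pow_unbounded_of_one_lt (1 / |y - y'|) (one_lt_two : (1 : ℝ) < 2)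
    have h1 := (radixWalk_agree hy hy' k fun i _ => hall i).2
    have h2 := radixWalk_mem (N := N) (child := child) hy k
    have h3 := radixWalk_mem (N := N) (child := child) hy' k
    have h4 : (2 : ℝ) ^ k ≤ ∏ i ∈ Finset.range k, (N i : ℝ) := by
      calc (2 : ℝ) ^ k = ∏ i ∈ Finset.range k, (2 : ℝ) := by simp
        _ ≤ _ := Finset.prod_le_prod (fun _ _ => by norm_num) fun i _ => by exact_mod_cast hN2 i
    have h5 : (∏ i ∈ Finset.range k, (N i : ℝ)) * |y - y'| ≤ 1 := by
      rw [← abs_of_nonneg (a := ∏ i ∈ Finset.range k, (N i : ℝ)) (by positivity), ← abs_mul, h1,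
        abs_le]
      constructor <;> linarith [h2.1, h2.2, h3.1, h3.2]
    rw [div_lt_iff₀ hpos] at hk
    nlinarith
  classical
  set k := Nat.find hdiff
  have hk := Nat.find_spec hdiff
  have hmin : ∀ i < k, ⌊N i * (radixWalk N child y i).1⌋₊ = ⌊N i * (radixWalk N child y' i).1⌋₊ :=
    fun i hi => not_not.1 (Nat.find_min hdiff hi)
  obtain ⟨hu, hprod⟩ := radixWalk_agree hy hy' k hmin
  set t := ∑ i ∈ Finset.range k, m i
  have h2 := radixWalk_mem (N := N) (child := child) hy k
  have h3 := radixWalk_mem (N := N) (child := child) hy' k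
  have hyy : |y - y'| ≤ Real.exp (-(d * t)) := by
    have h4 : Real.exp (d * t) ≤ ∏ i ∈ Finset.range k, (N i : ℝ) := by
      rw [Finset.mul_sum, Real.exp_sum]
      exact Finset.prod_le_prod (fun _ _ => (Real.exp_pos _).le) fun i _ => hN i
    have h5 : (∏ i ∈ Finset.range k, (N i : ℝ)) * |y - y'| ≤ 1 := by
      rw [← abs_of_nonneg (a := ∏ i ∈ Finset.range k, (N i : ℝ)) (by positivity), ← abs_mul,
        hprod, abs_le]
      constructor <;> linarith [h2.1, h2.2, h3.1, h3.2]
    rw [Real.exp_neg, ← one_div, le_div_iff₀ (Real.exp_pos _), mul_comm]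
    exact (mul_le_mul_of_nonneg_right h4 (abs_nonneg _)).trans h5
  have hx := hf y (k + 1)
  have hx' := hf y' (k + 1)
  simp only [radixWalk] at hx hx'
  rw [← hu] at hx'
  have hs := hsep k _ _ _ (radixWalk_digit_lt hN0 hy k) (radixWalk_digit_lt hN0 hy' k) hk _ hx _ hx'
  have hrat := ratio_radixWalk_ge hN0 hr hy k
  have hdist : Real.exp (-(t + m k)) ≤ K / r [] * |f y - f y'| := by
    rw [div_mul_eq_mul_div, le_div_iff₀ hr0, neg_add, Real.exp_add]
    refine le_trans ?_ hs
    rw [mul_comm, ← mul_assoc]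
    exact mul_le_mul_of_nonneg_right hrat (Real.exp_pos _).le
  calc |y - y'| ≤ Real.exp (-(d * t)) := hyy
    _ ≤ Real.exp (K' + -(t + m k) * e) := by
      rw [Real.exp_le_exp]; linarith [hgrow k]
    _ = Real.exp K' * Real.exp (-(t + m k)) ^ e := by rw [Real.exp_add, Real.exp_mul]
    _ ≤ Real.exp K' * (K / r [] * |f y - f y'|) ^ e := by gcongr
    _ = _ := by rw [Real.mul_rpow (by positivity) (abs_nonneg _)]; ring

lemma ediam_closedBall_real (x ρ : ℝ) : ediam (closedBall x ρ) = ENNReal.ofReal (2 * ρ) := by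
  rw [Real.closedBall_eq_Icc, Real.ediam_Icc]
  congr 1; ring

lemma exists_separated_or_cover (E : Set ℝ) {ρ : ℝ} (N : ℕ) :
    (∃ f : ℕ → ℝ, (∀ i < N, f i ∈ E) ∧ ∀ i j, i < N → j < N → i ≠ j → ρ < |f i - f j|) ∨
      ∃ S : Finset ℝ, S.card < N ∧ (∀ x ∈ S, x ∈ E) ∧ E ⊆ ⋃ x ∈ S, closedBall x ρ := by
  classical
  induction N with
  | zero => exact Or.inl ⟨fun _ => 0, by simp, by simp⟩
  | succ N ih =>
    rcases ih with ⟨f, hfE, hf⟩ | ⟨S, hS, hSE, hcov⟩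
    · by_cases hc : E ⊆ ⋃ x ∈ (Finset.range N).image f, closedBall x ρ
      · refine Or.inr ⟨_, Nat.lt_succ_of_le (Finset.card_image_le.trans (by simp)), ?_, hc⟩
        intro x hx
        obtain ⟨i, hi, rfl⟩ := Finset.mem_image.1 hx
        exact hfE i (Finset.mem_range.1 hi)
      · obtain ⟨z, hzE, hz⟩ := not_subset.1 hc
        have hz' : ∀ i < N, ρ < |z - f i| := by
          intro i hi
          by_contra! hle
          exact hz (mem_iUnion₂.2 ⟨f i, Finset.mem_image_of_mem f (Finset.mem_range.2 hi),
            by simpa [Real.dist_eq] using hle⟩)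
        refine Or.inl ⟨fun i => if i < N then f i else z, fun i _ => ?_, fun i j hi hj hij => ?_⟩
        · by_cases h : i < N
          · simpa [h] using hfE i h
          · simpa [h] using hzE
        · by_cases h : i < N <;> by_cases h' : j < N
          · simpa [h, h'] using hf i j h h' hij
          · simpa [h, h', abs_sub_comm] using hz' i h
          · simpa [h, h'] using hz' j h'
          · omega
    · exact Or.inr ⟨S, hS.trans N.lt_succ_self, hSE, hcov⟩

namespace ConformalSystem

variable {ι : Type} {X : Set ℝ} {φ : List ι → ℝ → ℝ} {r : List ι → ℝ} {C : ℝ}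

lemma pos (h : ConformalSystem X φ r C) : 0 < C := one_pos.trans_le h.one_le

lemma image_subset (h : ConformalSystem X φ r C) (w : List ι) : φ w '' X ⊆ X := by
  rintro _ ⟨x, hx, rfl⟩; exact h.mapsTo w x hx

lemma abs_sub_le_of_mem (h : ConformalSystem X φ r C) {w : List ι} {x y : ℝ}
    (hx : x ∈ φ w '' X) (hy : y ∈ φ w '' X) : |x - y| ≤ C ^ 2 * r w := by
  obtain ⟨x, hx, rfl⟩ := hx
  obtain ⟨y, hy, rfl⟩ := hy
  have h1 := h.upper w x hx y hy
  have h2 := h.diam_le x hx y hy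
  have h3 := h.ratio_pos w
  have h4 := h.pos
  calc _ ≤ C * r w * |x - y| := h1
    _ ≤ C * r w * C := by gcongr
    _ = _ := by ring

/-- Separated points of the attractor lie in separated cylinders of comparable size. -/
lemma exists_separated_cylinders (h : ConformalSystem X φ r C) {a : ℝ} (ha : 0 < a) (ha1 : a ≤ 1)
    {N : ℕ} {f : ℕ → ℝ} (hf : ∀ i < N, f i ∈ X)
    (hsep : ∀ i j, i < N → j < N → i ≠ j → (2 * C ^ 2 + 1) * a < |f i - f j|) :
    ∃ w : ℕ → List ι, (∀ i < N, f i ∈ φ (w i) '' X ∧ r (w i) ≤ a ∧ a ≤ C * r (w i)) ∧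
      ∀ i j, i < N → j < N → i ≠ j → ∀ x ∈ φ (w i) '' X, ∀ y ∈ φ (w j) '' X, a ≤ |x - y| := by
  have hex : ∀ i, ∃ w, i < N → f i ∈ φ w '' X ∧ r w ≤ a ∧ a ≤ C * r w := by
    intro i
    by_cases hi : i < N
    · obtain ⟨w, hw⟩ := h.exists_cylinder (f i) (hf i hi) a ha ha1
      exact ⟨w, fun _ => hw⟩
    · exact ⟨[], fun h => (hi h).elim⟩
  choose w hw using hex
  refine ⟨w, hw, fun i j hi hj hij x hx y hy => ?_⟩
  have h1 := h.abs_sub_le_of_mem (hw i hi).1 hx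
  have h2 := h.abs_sub_le_of_mem hy (hw j hj).1
  have h3 := hsep i j hi hj hij
  have h4 : C ^ 2 * r (w i) ≤ C ^ 2 * a := by gcongr; exact (hw i hi).2.1
  have h5 : C ^ 2 * r (w j) ≤ C ^ 2 * a := by gcongr; exact (hw j hj).2.1
  have h6 : |f i - f j| ≤ |f i - x| + |x - y| + |y - f j| := by
    have e : f i - f j = (f i - x) + (x - y) + (y - f j) := by ring
    rw [e]; exact abs_add_three _ _ _
  linarith

lemma ratio_append_ge (h : ConformalSystem X φ r C) {a : ℝ} (u : List ι) {w : List ι}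
    (hw : a ≤ C * r w) : r u * Real.exp (-(Real.log (C ^ 2 / a))) ≤ r (u ++ w) ∨ a ≤ 0 := by
  rcases le_or_gt a 0 with ha | ha
  · exact Or.inr ha
  left
  have hC := h.pos
  rw [Real.exp_neg, Real.exp_log (by positivity), inv_div, mul_div_assoc',
    div_le_iff₀ (by positivity)]
  have h1 := h.le_ratio_append u w
  calc r u * a ≤ r u * (C * r w) := mul_le_mul_of_nonneg_left hw (h.ratio_pos u).le
    _ = C * (r u * r w) := by ring
    _ ≤ C * (C * r (u ++ w)) := mul_le_mul_of_nonneg_left h1 hC.le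
    _ = _ := by ring

lemma separated_append (h : ConformalSystem X φ r C) {a : ℝ} (ha : 0 < a) (u : List ι)
    {v w : List ι} (hvw : ∀ x ∈ φ v '' X, ∀ y ∈ φ w '' X, a ≤ |x - y|) :
    ∀ x ∈ φ (u ++ v) '' X, ∀ y ∈ φ (u ++ w) '' X,
      r u * Real.exp (-(Real.log (C ^ 2 / a))) ≤ C * |x - y| := by
  rintro _ ⟨x, hx, rfl⟩ _ ⟨y, hy, rfl⟩
  have hC := h.pos
  rw [h.append, h.append]
  have h1 := h.lower u _ (h.mapsTo v x hx) _ (h.mapsTo w y hy)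
  have h2 := hvw _ (mem_image_of_mem _ hx) _ (mem_image_of_mem _ hy)
  refine le_trans (mul_le_mul_of_nonneg_left ?_ (h.ratio_pos u).le) h1
  rw [Real.exp_neg, Real.exp_log (by positivity), inv_div]
  refine le_trans (div_le_self ha.le ?_) h2
  nlinarith [h.one_le]

/-- The cardinality of a separated subset of the attractor is controlled by its dimension. -/
lemma card_separated_le (h : ConformalSystem X φ r C) (hXc : IsCompact X) (hXne : X.Nonempty)
    {s : ℝ} (hs : dimH X = ENNReal.ofReal s) (hspos : 0 < s) {a : ℝ} (ha : 0 < a) (ha1 : a < 1)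
    {N : ℕ} (hN : 2 ≤ N) {f : ℕ → ℝ} (hf : ∀ i < N, f i ∈ X)
    (hsep : ∀ i j, i < N → j < N → i ≠ j → (2 * C ^ 2 + 1) * a < |f i - f j|) :
    (N : ℝ) ≤ (C ^ 2 / a) ^ s := by
  have hC := h.pos
  have hC1 := h.one_le
  obtain ⟨w, hw, hwsep⟩ := h.exists_separated_cylinders ha ha1.le hf hsep
  set m := Real.log (C ^ 2 / a) with hm
  have hm0 : 0 < m := Real.log_pos (by rw [lt_div_iff₀ ha]; nlinarith)
  have hN1 : (1 : ℝ) < N := by exact_mod_cast hN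
  set d := Real.log N / m with hd
  have hd0 : 0 < d := div_pos (Real.log_pos hN1) hm0
  have hdm : d * m = Real.log N := by rw [hd]; field_simp
  have key := h.le_dimH_moran hXc hXne (N := fun _ => N) (m := fun _ => m)
    (child := fun _ _ i => w i) (d := d) (e := d) (K := C) (K' := d * m) hd0 hC (fun _ => hN)
    (fun _ => by rw [hdm, Real.exp_log (by linarith)])
    (fun _ u i hi => (h.ratio_append_ge u (hw i hi).2.2).resolve_right (not_le.2 ha))
    (fun _ u i j hi hj hij => h.separated_append ha u (hwsep i j hi hj hij))
    (fun k => by linarith)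
  have h1 := key.trans ((dimH_mono (sep_subset _ _)).trans hs.le)
  rw [ENNReal.ofReal_le_ofReal_iff hspos.le] at h1
  have h2 : Real.log N ≤ s * m := by rw [← hdm]; gcongr
  calc (N : ℝ) = Real.exp (Real.log N) := (Real.exp_log (by linarith)).symm
    _ ≤ Real.exp (m * s) := by rw [Real.exp_le_exp]; linarith
    _ = _ := by rw [Real.exp_mul, hm, Real.exp_log (by positivity)]

theorem hausdorffMeasure_ne_top (h : ConformalSystem X φ r C) (hXc : IsCompact X)
    (hXne : X.Nonempty) {s : ℝ} (hs : dimH X = ENNReal.ofReal s) (hspos : 0 < s) :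
    μH[s] X ≠ ∞ := by
  have hC := h.pos
  have hC1 := h.one_le
  set Q := 2 * C ^ 2 + 1
  have hQ : 0 < Q := by positivity
  set a : ℕ → ℝ := fun n => 1 / ((n : ℝ) + 2) with ha
  have ha0 : ∀ n, 0 < a n := fun n => by positivity
  have ha1 : ∀ n, a n < 1 := fun n => by
    simp only [ha]; rw [div_lt_one (by positivity)]; linarith [(Nat.cast_nonneg n : (0 : ℝ) ≤ n)]
  have hlim : Tendsto a atTop (𝓝 0) := by
    have := (tendsto_one_div_add_atTop_nhds_zero_nat (𝕜 := ℝ)).comp (tendsto_add_atTop_nat 1)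
    refine this.congr fun n => ?_
    simp only [Function.comp, ha]; push_cast; ring_nf
  have hcov : ∀ n, ∃ S : Finset ℝ, (S.card : ℝ) ≤ (C ^ 2 / a n) ^ s ∧
      X ⊆ ⋃ x ∈ S, closedBall x (Q * a n) := by
    intro n
    have hone : 1 ≤ (C ^ 2 / a n) ^ s := by
      refine Real.one_le_rpow ?_ hspos.le
      rw [le_div_iff₀ (ha0 n)]; nlinarith [ha1 n]
    have hfl : 1 ≤ ⌊(C ^ 2 / a n) ^ s⌋₊ := Nat.le_floor (by exact_mod_cast hone)
    rcases exists_separated_or_cover X (ρ := Q * a n) (⌊(C ^ 2 / a n) ^ s⌋₊ + 1) with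
      ⟨f, hf, hsep⟩ | ⟨S, hS, -, hc⟩
    · have := h.card_separated_le hXc hXne hs hspos (ha0 n) (ha1 n) (by omega) hf hsep
      have h2 := Nat.lt_floor_add_one ((C ^ 2 / a n) ^ s)
      push_cast at this
      linarith
    · refine ⟨S, ?_, hc⟩
      exact (Nat.cast_le.2 (Nat.lt_succ_iff.1 hS)).trans
        (Nat.floor_le (zero_le_one.trans hone))
  choose S hScard hScov using hcov
  have hQa : Tendsto (fun n => ENNReal.ofReal (2 * (Q * a n))) atTop (𝓝 0) := by
    have := (hlim.const_mul Q).const_mul 2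
    simpa using ENNReal.tendsto_ofReal this
  have hbound : ∀ n, ∑ i : S n, ediam (closedBall (i : ℝ) (Q * a n)) ^ s ≤
      ENNReal.ofReal ((2 * Q * C ^ 2) ^ s) := by
    intro n
    have h1 : 0 ≤ 2 * (Q * a n) := by have := ha0 n; positivity
    simp only [ediam_closedBall_real, Finset.sum_const, Finset.card_univ, Fintype.card_coe,
      nsmul_eq_mul]
    rw [ENNReal.ofReal_rpow_of_nonneg h1 hspos.le, ← ENNReal.ofReal_natCast,
      ← ENNReal.ofReal_mul (Nat.cast_nonneg _)]
    refine ENNReal.ofReal_le_ofReal ?_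
    calc ((S n).card : ℝ) * (2 * (Q * a n)) ^ s
        ≤ (C ^ 2 / a n) ^ s * (2 * (Q * a n)) ^ s := by gcongr; exact hScard n
      _ = (2 * Q * C ^ 2) ^ s := by
        rw [← Real.mul_rpow (by have := ha0 n; positivity) h1]
        congr 1
        have := (ha0 n).ne'
        field_simp
  have := Measure.hausdorffMeasure_le_liminf_sum s X (l := atTop)
    (fun n => ENNReal.ofReal (2 * (Q * a n))) hQa
    (fun n (i : S n) => closedBall (i : ℝ) (Q * a n))
    (Eventually.of_forall fun n i => (ediam_closedBall_real _ _).le)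
    (Eventually.of_forall fun n x hx => by
      obtain ⟨y, hy, hxy⟩ := mem_iUnion₂.1 (hScov n hx)
      exact mem_iUnion.2 ⟨⟨y, hy⟩, hxy⟩)
  refine ne_top_of_le_ne_top (b := ENNReal.ofReal ((2 * Q * C ^ 2) ^ s)) ENNReal.ofReal_ne_top
    (this.trans ?_)
  refine (liminf_le_liminf (Eventually.of_forall hbound)).trans ?_
  rw [liminf_const]

end ConformalSystem

/-- The family of `k`-fold compositions of a finite covering family of Lipschitz maps. -/
lemma exists_iterated_cover {X : Set ℝ} {J : Type} [Fintype J] {ψ : J → ℝ → ℝ} {a : J → ℝ}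
    {t : ℝ} (ha : ∀ j, 0 < a j) (hmaps : ∀ j, MapsTo (ψ j) X X)
    (hlip : ∀ j, ∀ x ∈ X, ∀ y ∈ X, |ψ j x - ψ j y| ≤ a j * |x - y|) (hcov : X ⊆ ⋃ j, ψ j '' X)
    (k : ℕ) : ∃ (J' : Type) (_ : Fintype J') (ψ' : J' → ℝ → ℝ) (a' : J' → ℝ), (∀ j, 0 < a' j) ∧
      (∀ j, MapsTo (ψ' j) X X) ∧
      (∀ j, ∀ x ∈ X, ∀ y ∈ X, |ψ' j x - ψ' j y| ≤ a' j * |x - y|) ∧ (X ⊆ ⋃ j, ψ' j '' X) ∧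
      ∑ j, a' j ^ t = (∑ j, a j ^ t) ^ k := by
  induction k with
  | zero =>
    exact ⟨Unit, inferInstance, fun _ => id, fun _ => 1, by simp, fun _ => mapsTo_id _, by simp,
      fun x hx => mem_iUnion.2 ⟨(), x, hx, rfl⟩, by simp⟩
  | succ k ih =>
    obtain ⟨J', _, ψ', a', h1, h2, h3, h4, h5⟩ := ih
    refine ⟨J' × J, inferInstance, fun p => ψ' p.1 ∘ ψ p.2, fun p => a' p.1 * a p.2,
      fun p => mul_pos (h1 _) (ha _), fun p => (h2 p.1).comp (hmaps p.2), fun p x hx y hy => ?_,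
      fun x hx => ?_, ?_⟩
    · refine (h3 p.1 _ (hmaps p.2 hx) _ (hmaps p.2 hy)).trans ?_
      rw [mul_assoc]
      exact mul_le_mul_of_nonneg_left (hlip p.2 x hx y hy) (h1 _).le
    · obtain ⟨j', y, hy, rfl⟩ := mem_iUnion.1 (h4 hx)
      obtain ⟨j, z, hz, rfl⟩ := mem_iUnion.1 (hcov hy)
      exact mem_iUnion.2 ⟨(j', j), z, hz, rfl⟩
    · rw [pow_succ, ← h5, Finset.sum_mul_sum, Fintype.sum_prod_type]
      refine Finset.sum_congr rfl fun i _ => Finset.sum_congr rfl fun j _ => ?_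
      exact Real.mul_rpow (h1 _).le (ha _).le

lemma dimH_le_of_lipschitz_cover {X : Set ℝ} {J : Type} [Fintype J] {ψ : J → ℝ → ℝ} {a : J → ℝ}
    {t : ℝ} (ht : 0 < t) {D : ℝ} (hD0 : 0 ≤ D) (hD : ∀ x ∈ X, ∀ y ∈ X, |x - y| ≤ D)
    (ha : ∀ j, 0 < a j) (hmaps : ∀ j, MapsTo (ψ j) X X)
    (hlip : ∀ j, ∀ x ∈ X, ∀ y ∈ X, |ψ j x - ψ j y| ≤ a j * |x - y|) (hcov : X ⊆ ⋃ j, ψ j '' X)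
    (hsum : ∑ j, a j ^ t < 1) : dimH X ≤ ENNReal.ofReal t := by
  choose J' hJ' ψ' a' h1 h2 h3 h4 h5 using exists_iterated_cover (t := t) ha hmaps hlip hcov
  set q := ∑ j, a j ^ t
  have hq0 : 0 ≤ q := Finset.sum_nonneg fun j _ => Real.rpow_nonneg (ha j).le _
  have hdiam : ∀ k (j : J' k), ediam (ψ' k j '' X) ≤ ENNReal.ofReal (a' k j * D) := by
    intro k j
    refine ediam_le ?_
    rintro _ ⟨x, hx, rfl⟩ _ ⟨y, hy, rfl⟩
    rw [edist_dist, Real.dist_eq]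
    exact ENNReal.ofReal_le_ofReal ((h3 k j x hx y hy).trans
      (mul_le_mul_of_nonneg_left (hD x hx y hy) (h1 k j).le))
  have hpow : Tendsto (fun k : ℕ => q ^ k) atTop (𝓝 0) :=
    tendsto_pow_atTop_nhds_zero_of_lt_one hq0 hsum
  have hlim : Tendsto (fun k : ℕ => ENNReal.ofReal ((q ^ k) ^ (1 / t) * D)) atTop (𝓝 0) := by
    have := (hpow.rpow_const (p := 1 / t) (Or.inr (by positivity))).mul_const D
    rw [Real.zero_rpow (by positivity), zero_mul] at this
    simpa using ENNReal.tendsto_ofReal this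
  have ha' : ∀ k j, a' k j ≤ (q ^ k) ^ (1 / t) := by
    intro k j
    have : a' k j ^ t ≤ q ^ k := by
      rw [← h5 k]
      exact Finset.single_le_sum (f := fun j => a' k j ^ t)
        (fun i _ => Real.rpow_nonneg (h1 k i).le _) (Finset.mem_univ j)
    calc a' k j = (a' k j ^ t) ^ (1 / t) := by
          rw [← Real.rpow_mul (h1 k j).le, mul_one_div_cancel ht.ne', Real.rpow_one]
      _ ≤ _ := Real.rpow_le_rpow (Real.rpow_nonneg (h1 k j).le _) this (by positivity)
  have key := Measure.hausdorffMeasure_le_liminf_sum t X (l := atTop)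
    (fun k => ENNReal.ofReal ((q ^ k) ^ (1 / t) * D)) hlim (fun k j => ψ' k j '' X)
    (Eventually.of_forall fun k j => (hdiam k j).trans (ENNReal.ofReal_le_ofReal
      (mul_le_mul_of_nonneg_right (ha' k j) hD0)))
    (Eventually.of_forall h4)
  have hbound : ∀ k, ∑ j, ediam (ψ' k j '' X) ^ t ≤ ENNReal.ofReal (q ^ k * D ^ t) := by
    intro k
    have : ∀ j, ediam (ψ' k j '' X) ^ t ≤ ENNReal.ofReal (a' k j ^ t * D ^ t) := by
      intro j
      refine (ENNReal.rpow_le_rpow (hdiam k j) ht.le).trans ?_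
      rw [ENNReal.ofReal_rpow_of_nonneg (mul_nonneg (h1 k j).le hD0) ht.le,
        Real.mul_rpow (h1 k j).le hD0]
    refine (Finset.sum_le_sum fun j _ => this j).trans ?_
    rw [← ENNReal.ofReal_sum_of_nonneg, ← Finset.sum_mul, h5]
    intro j _
    exact mul_nonneg (Real.rpow_nonneg (h1 k j).le _) (Real.rpow_nonneg hD0 _)
  have hzero : Tendsto (fun k : ℕ => ENNReal.ofReal (q ^ k * D ^ t)) atTop (𝓝 0) := by
    have := hpow.mul_const (D ^ t)
    rw [zero_mul] at this
    simpa using ENNReal.tendsto_ofReal this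
  have h6 : μH[t] X ≤ 0 := by
    refine key.trans ?_
    rw [← hzero.liminf_eq]
    exact liminf_le_liminf (Eventually.of_forall hbound)
  have : ((t.toNNReal : ℝ≥0) : ℝ) = t := Real.coe_toNNReal _ ht.le
  refine dimH_le_of_hausdorffMeasure_ne_top (d := t.toNNReal) ?_
  rw [this]
  exact ne_top_of_le_ne_top ENNReal.zero_ne_top h6

namespace ConformalSystem

variable {ι : Type} {X : Set ℝ} {φ : List ι → ℝ → ℝ} {r : List ι → ℝ} {C : ℝ}

lemma hausdorffMeasure_ne_zero (h : ConformalSystem X φ r C) (hXc : IsCompact X)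
    (hXne : X.Nonempty) {s : ℝ} (hs : dimH X = ENNReal.ofReal s) (hspos : 0 < s) :
    μH[s] X ≠ 0 := by
  intro h0
  have hC := h.pos
  set A := (2 * C ^ 3) ^ s with hA
  have hA0 : 0 < A := by positivity
  set ε := 1 / (4 * A) with hεd
  have hε : 0 < ε := by positivity
  obtain ⟨x0, hx0⟩ := hXne
  rw [Measure.hausdorffMeasure_apply] at h0
  have h1 : (⨅ (t : ℕ → Set ℝ) (_ : X ⊆ ⋃ n, t n) (_ : ∀ n, ediam (t n) ≤ 1),
      ∑' n, ⨆ _ : (t n).Nonempty, ediam (t n) ^ s) < ENNReal.ofReal ε := by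
    refine lt_of_le_of_lt ?_ (ENNReal.ofReal_pos.2 hε)
    rw [← h0]
    exact le_iSup₂_of_le (1 : ℝ≥0∞) one_pos le_rfl
  simp only [iInf_lt_iff] at h1
  obtain ⟨U, hU, -, hsum⟩ := h1
  set q : ℕ → ℝ≥0∞ := fun n => ⨆ _ : (U n).Nonempty, ediam (U n) ^ s with hq
  have hqtop : ∀ n, q n ≠ ∞ := fun n =>
    ne_top_of_le_ne_top ENNReal.ofReal_ne_top ((ENNReal.le_tsum n).trans hsum.le)
  set v : ℕ → ℝ := fun n => (q n).toReal + ε / 2 / 2 ^ n with hv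
  have hv0 : ∀ n, 0 < v n := fun n => by
    have : 0 ≤ (q n).toReal := ENNReal.toReal_nonneg
    simp only [hv]; positivity
  have hvsum : ∀ F : Finset ℕ, ∑ n ∈ F, v n ≤ 2 * ε := by
    intro F
    simp only [hv, Finset.sum_add_distrib]
    have e1 : ∑ n ∈ F, (q n).toReal ≤ ε := by
      rw [← ENNReal.toReal_sum fun n _ => hqtop n]
      exact ENNReal.toReal_le_of_le_ofReal hε.le ((ENNReal.sum_le_tsum F).trans hsum.le)
    have e2 : ∑ n ∈ F, ε / 2 / 2 ^ n ≤ ε := by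
      refine ((summable_geometric_two' ε).sum_le_tsum F fun n _ => by positivity).trans ?_
      rw [tsum_geometric_two']
    linarith
  set b : ℕ → ℝ := fun n => v n ^ (1 / s) with hb
  have hb0 : ∀ n, 0 < b n := fun n => Real.rpow_pos_of_pos (hv0 n) _
  have hbs : ∀ n, b n ^ s = v n := fun n => by
    simp only [hb]
    rw [← Real.rpow_mul (hv0 n).le, one_div_mul_cancel hspos.ne', Real.rpow_one]
  have hUb : ∀ n, ∀ x ∈ U n, ∀ z ∈ U n, |x - z| < b n := by
    intro n x hx z hz
    have e1 : edist x z ^ s ≤ q n := by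
      simp only [hq]
      rw [ciSup_pos ⟨x, hx⟩]
      exact ENNReal.rpow_le_rpow (edist_le_ediam_of_mem hx hz) hspos.le
    rw [edist_dist, Real.dist_eq, ENNReal.ofReal_rpow_of_nonneg (abs_nonneg _) hspos.le] at e1
    have e2 := (ENNReal.ofReal_le_iff_le_toReal (hqtop n)).1 e1
    rw [← Real.rpow_lt_rpow_iff (abs_nonneg _) (hb0 n).le hspos, hbs]
    refine e2.trans_lt ?_
    simp only [hv]
    have : 0 < ε / 2 / 2 ^ n := by positivity
    linarith
  have hcen : ∀ n, ∃ c ∈ X, ∀ z ∈ X, z ∈ U n → |c - z| < b n := by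
    intro n
    by_cases hn : (U n ∩ X).Nonempty
    · obtain ⟨c, hc, hcX⟩ := hn
      exact ⟨c, hcX, fun z _ hz => hUb n c hc z hz⟩
    · exact ⟨x0, hx0, fun z hzX hz => (hn ⟨z, hz, hzX⟩).elim⟩
  choose c hcX hc using hcen
  obtain ⟨T, hT⟩ := hXc.elim_finite_subcover (fun n => ball (c n) (b n)) (fun n => isOpen_ball)
    (fun z hz => by
      obtain ⟨n, hn⟩ := mem_iUnion.1 (hU hz)
      refine mem_iUnion.2 ⟨n, ?_⟩
      rw [mem_ball, dist_comm, Real.dist_eq]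
      exact hc n z hz hn)
  have hbA : ∀ n, (2 * C ^ 3 * b n) ^ s = A * v n := fun n => by
    rw [Real.mul_rpow (by positivity) (hb0 n).le, hbs]
  have hb1 : ∀ n, 2 * C ^ 2 * b n ≤ 1 := by
    intro n
    have e1 : (2 * C ^ 3 * b n) ^ s ≤ 1 := by
      rw [hbA]
      have := hvsum {n}
      rw [Finset.sum_singleton] at this
      calc A * v n ≤ A * (2 * ε) := by gcongr
        _ = 1 / 2 := by rw [hεd]; field_simp; norm_num
        _ ≤ 1 := by norm_num
    have e2 : 2 * C ^ 3 * b n ≤ 1 := by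
      by_contra! hlt
      exact absurd e1 (not_le.2 (Real.one_lt_rpow hlt hspos))
    refine le_trans ?_ e2
    have := hb0 n
    have := h.one_le
    gcongr
    norm_num
  have hw : ∀ n, ∃ w, c n ∈ φ w '' X ∧ r w ≤ 2 * C ^ 2 * b n ∧ 2 * C ^ 2 * b n ≤ C * r w :=
    fun n => h.exists_cylinder (c n) (hcX n) _ (by have := hb0 n; positivity) (hb1 n)
  choose w hwc hw1 hw2 using hw
  have hcov : X ⊆ ⋃ j : T, φ (w j) '' X := by
    intro z hz
    obtain ⟨n, hn, hzn⟩ := mem_iUnion₂.1 (hT hz)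
    refine mem_iUnion.2 ⟨⟨n, hn⟩, ?_⟩
    by_contra hcon
    have e1 := h.gap (w n) (c n) (hwc n) z hz hcon
    rw [mem_ball, dist_comm, Real.dist_eq] at hzn
    have e2 : C * (2 * C * b n) ≤ C * r (w n) := by nlinarith [hw2 n]
    have e3 := le_of_mul_le_mul_left e2 hC
    have e4 : C * |c n - z| < C * b n := mul_lt_mul_of_pos_left hzn hC
    have := mul_pos hC (hb0 n)
    linarith
  have hsumlt : ∑ j : T, (C * r (w j)) ^ s < 1 := by
    calc ∑ j : T, (C * r (w j)) ^ s ≤ ∑ j : T, A * v j := by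
          refine Finset.sum_le_sum fun j _ => ?_
          rw [← hbA]
          have := h.ratio_pos (w j)
          refine Real.rpow_le_rpow (by positivity) ?_ hspos.le
          nlinarith [hw1 j]
      _ = A * ∑ n ∈ T, v n := by rw [← Finset.mul_sum, Finset.sum_coe_sort T v]
      _ ≤ A * (2 * ε) := by gcongr; exact hvsum T
      _ = 1 / 2 := by rw [hεd]; field_simp; norm_num
      _ < 1 := by norm_num
  have hcont : ContinuousAt (fun t : ℝ => ∑ j : T, (C * r (w j)) ^ t) s := by
    refine tendsto_finsetSum _ fun j _ => ?_
    exact Real.continuousAt_const_rpow (mul_pos hC (h.ratio_pos _)).ne'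
  have hev : ∀ᶠ t in 𝓝[<] s, (∑ j : T, (C * r (w j)) ^ t < 1 ∧ 0 < t) ∧ t < s :=
    ((((hcont.eventually (gt_mem_nhds hsumlt)).and (lt_mem_nhds hspos)).filter_mono
      nhdsWithin_le_nhds)).and self_mem_nhdsWithin
  obtain ⟨t, ⟨ht1, ht0⟩, hts⟩ := hev.exists
  have := dimH_le_of_lipschitz_cover ht0 hC.le h.diam_le
    (fun j : T => mul_pos hC (h.ratio_pos (w j)))
    (fun j : T => h.mapsTo (w j)) (fun j x hx y hy => h.upper (w j) x hx y hy) hcov ht1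
  rw [hs] at this
  exact absurd ((ENNReal.ofReal_le_ofReal_iff ht0.le).1 this) (not_le.2 hts)

end ConformalSystem

lemma hausdorffMeasure_image_le_of_abs_le {f : ℝ → ℝ} {B : Set ℝ} {c s : ℝ} (hc : 0 ≤ c)
    (hs : 0 ≤ s) (hf : ∀ x ∈ B, ∀ y ∈ B, |f x - f y| ≤ c * |x - y|) :
    μH[s] (f '' B) ≤ ENNReal.ofReal (c ^ s) * μH[s] B := by
  have hl : LipschitzOnWith c.toNNReal f B := LipschitzOnWith.of_dist_le_mul fun x hx y hy => by
    rw [Real.dist_eq, Real.dist_eq, Real.coe_toNNReal _ hc]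
    exact hf x hx y hy
  refine (hl.hausdorffMeasure_image_le hs).trans_eq ?_
  rw [← ENNReal.ofReal_rpow_of_nonneg hc hs]
  rfl

lemma hausdorffMeasure_le_image_of_abs_le {f : ℝ → ℝ} {B : Set ℝ} {c s : ℝ} (hc : 0 ≤ c)
    (hs : 0 ≤ s) (hf : ∀ x ∈ B, ∀ y ∈ B, |x - y| ≤ c * |f x - f y|) :
    μH[s] B ≤ ENNReal.ofReal (c ^ s) * μH[s] (f '' B) := by
  have hinj : InjOn f B := fun x hx y hy hxy => by
    have := hf x hx y hy
    rw [hxy, sub_self, abs_zero, mul_zero] at this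
    exact sub_eq_zero.1 (abs_nonpos_iff.1 this)
  have hinv : ∀ x ∈ B, Function.invFunOn f B (f x) = x := fun x hx => hinj.leftInvOn_invFunOn hx
  have himg : Function.invFunOn f B '' (f '' B) = B := by
    rw [image_image]
    exact (image_congr hinv).trans (image_id' B)
  have := hausdorffMeasure_image_le_of_abs_le (f := Function.invFunOn f B) (B := f '' B) hc hs (by
    rintro _ ⟨x, hx, rfl⟩ _ ⟨y, hy, rfl⟩
    rw [hinv x hx, hinv y hy]
    exact hf x hx y hy)
  rwa [himg] at this

/-- A probability measure on the attractor which scales like an `s`-dimensional measure. -/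
structure ConformalMeasure {ι : Type} (X : Set ℝ) (φ : List ι → ℝ → ℝ) (r : List ι → ℝ)
    (C s M : ℝ) (μ : Measure ℝ) : Prop extends IsProbabilityMeasure μ where
  nonneg : 0 ≤ M
  ball_le : ∀ x ∈ X, ∀ ρ, 0 < ρ → (μ (ball x ρ)).toReal ≤ M * ρ ^ s
  scaling : ∀ δ > 0, ∃ ρ₀ > 0, ∀ u, ∀ y ∈ X, ∃ lam, r u ≤ C * lam ∧ lam ≤ C * r u ∧
    ∀ ρ, 0 < ρ → ρ ≤ ρ₀ →
      (μ (ball (φ u y) (lam * ρ))).toReal ≤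
        (Real.exp δ * lam) ^ s * (μ (ball y (Real.exp δ * ρ))).toReal ∧
      (μ (ball y ρ)).toReal ≤
        (Real.exp δ / lam) ^ s * (μ (ball (φ u y) (lam * (Real.exp δ * ρ)))).toReal

namespace ConformalSystem

variable {ι : Type} {X : Set ℝ} {φ : List ι → ℝ → ℝ} {r : List ι → ℝ} {C s : ℝ} {μ : Measure ℝ}

lemma conformalMeasure (h : ConformalSystem X φ r C) (hXc : IsCompact X)
    (hspos : 0 < s) (h0 : μH[s] X ≠ 0) (htop : μH[s] X ≠ ∞)
    (hμ : μ = (μH[s] X)⁻¹ • (μH[s]).restrict X) :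
    ConformalMeasure X φ r C s ((2 * C ^ 3) ^ s) μ := by
  have hC := h.pos
  have hC1 := h.one_le
  have hμA : ∀ A, μ A = (μH[s] X)⁻¹ * μH[s] (A ∩ X) := fun A => by
    rw [hμ, Measure.smul_apply, Measure.restrict_apply' hXc.measurableSet, smul_eq_mul]
  have hprob : IsProbabilityMeasure μ := ⟨by
    rw [hμA, univ_inter, ENNReal.inv_mul_cancel h0 htop]⟩
  have hle : ∀ A B : Set ℝ, ∀ c : ℝ, 0 ≤ c →
      μH[s] (A ∩ X) ≤ ENNReal.ofReal c * μH[s] (B ∩ X) → (μ A).toReal ≤ c * (μ B).toReal := by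
    intro A B c hc hAB
    have : μ A ≤ ENNReal.ofReal c * μ B := by
      rw [hμA, hμA, mul_left_comm]
      gcongr
    have := ENNReal.toReal_mono (by finiteness) this
    rwa [ENNReal.toReal_mul, ENNReal.toReal_ofReal hc] at this
  refine { toIsProbabilityMeasure := hprob, nonneg := by positivity, ball_le := ?_, scaling := ?_ }
  · intro x hx ρ hρ
    have e0 : (μ univ).toReal = 1 := by simp
    rw [← Real.mul_rpow (by positivity) hρ.le]
    rcases le_or_gt (2 * C ^ 2 * ρ) 1 with h1 | h1
    · obtain ⟨w, hxw, hw1, hw2⟩ := h.exists_cylinder x hx (2 * C ^ 2 * ρ) (by positivity) h1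
      have hr := h.ratio_pos w
      have hsub : ball x ρ ∩ X ⊆ φ w '' X := by
        rintro z ⟨hz, hzX⟩
        by_contra hcon
        have e1 := h.gap w x hxw z hzX hcon
        rw [mem_ball, dist_comm, Real.dist_eq] at hz
        have e2 : C * (2 * C * ρ) ≤ C * r w := by nlinarith
        have e3 := le_of_mul_le_mul_left e2 hC
        have e4 : C * |x - z| < C * ρ := mul_lt_mul_of_pos_left hz hC
        have := mul_pos hC hρ
        linarith
      have := hle (ball x ρ) univ ((2 * C ^ 3 * ρ) ^ s) (by positivity) (by
        rw [univ_inter]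
        refine (measure_mono hsub).trans ((hausdorffMeasure_image_le_of_abs_le (by positivity)
          hspos.le (h.upper w)).trans ?_)
        have : C * r w ≤ 2 * C ^ 3 * ρ := by nlinarith
        gcongr)
      rwa [e0, mul_one] at this
    · have e1 : 1 ≤ (2 * C ^ 3 * ρ) ^ s := by
        refine Real.one_le_rpow ?_ hspos.le
        nlinarith [mul_pos (pow_pos hC 2) hρ]
      refine le_trans ?_ e1
      exact ENNReal.toReal_le_of_le_ofReal one_pos.le (by simpa using prob_le_one)
  · intro δ hδ
    obtain ⟨ρ₁, hρ₁, hsim⟩ := h.local_similarity δ hδ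
    have hE : 1 < Real.exp δ := Real.one_lt_exp_iff.2 hδ
    have hE0 := Real.exp_pos δ
    have hEi : Real.exp (-δ) * Real.exp δ = 1 := by rw [← Real.exp_add]; simp
    refine ⟨min (1 / (2 * C ^ 2)) (ρ₁ / (2 * C ^ 2 * Real.exp δ)), by positivity, ?_⟩
    intro u y hy
    obtain ⟨lam, hl1, hl2, hsim⟩ := hsim u y hy
    have hr := h.ratio_pos u
    have hlam : 0 < lam := by
      by_contra! hcon
      nlinarith
    refine ⟨lam, hl1, hl2, fun ρ hρ hρ₀ => ?_⟩
    have a1 : ρ * (2 * C ^ 2) ≤ 1 :=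
      (le_div_iff₀ (by positivity)).1 (hρ₀.trans (min_le_left _ _))
    have a2 : ρ * (2 * C ^ 2 * Real.exp δ) ≤ ρ₁ :=
      (le_div_iff₀ (by positivity)).1 (hρ₀.trans (min_le_right _ _))
    have hC2 : 1 ≤ C ^ 2 := one_le_pow₀ hC1
    have a3 : Real.exp δ * ρ < ρ₁ := by nlinarith [mul_pos hE0 hρ]
    have a4 : C ^ 2 * ρ < ρ₁ := by nlinarith [mul_pos (pow_pos hC 2) hρ]
    have a5 : ρ < ρ₁ := by nlinarith
    have hyρ : |y - y| < ρ₁ := by simpa using hρ₁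
    constructor
    · refine hle _ _ _ (by positivity) ?_
      have hsub : ball (φ u y) (lam * ρ) ∩ X ⊆ φ u '' (ball y (Real.exp δ * ρ) ∩ X) := by
        rintro z ⟨hz, hzX⟩
        rw [mem_ball, dist_comm, Real.dist_eq] at hz
        have hzu : z ∈ φ u '' X := by
          by_contra hcon
          have e1 := h.gap u _ (mem_image_of_mem _ hy) z hzX hcon
          have e2 : C * |φ u y - z| < C * (lam * ρ) := mul_lt_mul_of_pos_left hz hC
          have e3 : C * (lam * ρ) ≤ C * (C * r u * ρ) := by gcongr
          have e4 : C * (C * r u * ρ) = r u * (ρ * C ^ 2) := by ring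
          nlinarith
        obtain ⟨z', hz', rfl⟩ := hzu
        have e1 := h.lower u y hy z' hz'
        have e2 : r u * |y - z'| < r u * (C ^ 2 * ρ) := by
          calc r u * |y - z'| ≤ C * |φ u y - φ u z'| := e1
            _ < C * (lam * ρ) := mul_lt_mul_of_pos_left hz hC
            _ ≤ C * (C * r u * ρ) := by gcongr
            _ = _ := by ring
        have e3 := lt_of_mul_lt_mul_left e2 hr.le
        have e4 := (hsim z' hz' y hy (by rw [abs_sub_comm]; linarith) hyρ).1
        rw [abs_sub_comm (φ u z')] at e4
        refine ⟨z', ⟨?_, hz'⟩, rfl⟩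
        rw [mem_ball, Real.dist_eq]
        have e5 : lam * (Real.exp (-δ) * |z' - y|) < lam * ρ := by
          calc _ = Real.exp (-δ) * lam * |z' - y| := by ring
            _ < _ := e4.trans_lt hz
        have e6 := lt_of_mul_lt_mul_left e5 hlam.le
        calc |z' - y| = Real.exp δ * (Real.exp (-δ) * |z' - y|) := by
              rw [← mul_assoc, mul_comm (Real.exp δ), hEi, one_mul]
          _ < _ := mul_lt_mul_of_pos_left e6 hE0
      refine (measure_mono hsub).trans
        (hausdorffMeasure_image_le_of_abs_le (by positivity) hspos.le ?_)
      rintro a ⟨ha, haX⟩ b ⟨hb, hbX⟩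
      rw [mem_ball, Real.dist_eq] at ha hb
      exact (hsim a haX b hbX (ha.trans a3) (hb.trans a3)).2
    · refine hle _ _ _ (by positivity) ?_
      have hsub : φ u '' (ball y ρ ∩ X) ⊆ ball (φ u y) (lam * (Real.exp δ * ρ)) ∩ X := by
        rintro _ ⟨z, ⟨hz, hzX⟩, rfl⟩
        rw [mem_ball, Real.dist_eq] at hz
        refine ⟨?_, h.mapsTo u z hzX⟩
        rw [mem_ball, Real.dist_eq]
        calc |φ u z - φ u y| ≤ Real.exp δ * lam * |z - y| :=
              (hsim z hzX y hy (hz.trans a5) hyρ).2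
          _ < Real.exp δ * lam * ρ := mul_lt_mul_of_pos_left hz (by positivity)
          _ = _ := by ring
      refine (hausdorffMeasure_le_image_of_abs_le (c := Real.exp δ / lam) (by positivity)
        hspos.le ?_).trans (mul_le_mul_right (measure_mono hsub) _)
      rintro a ⟨ha, haX⟩ b ⟨hb, hbX⟩
      rw [mem_ball, Real.dist_eq] at ha hb
      have e1 := (hsim a haX b hbX (ha.trans a5) (hb.trans a5)).1
      calc |a - b| = Real.exp δ / lam * (Real.exp (-δ) * lam * |a - b|) := by
            rw [show Real.exp δ / lam * (Real.exp (-δ) * lam * |a - b|) =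
              (Real.exp (-δ) * Real.exp δ) * |a - b| * (lam / lam) by ring, hEi,
              div_self hlam.ne', mul_one, one_mul]
        _ ≤ _ := by gcongr

end ConformalSystem

/-- The integral `∫_a^b μ(B(x,ρ)) ρ^{-s-1} dρ`. -/
def densityIntegral (μ : Measure ℝ) (s x a b : ℝ) : ℝ :=
  ∫ ρ in a..b, (μ (ball x ρ)).toReal * ρ ^ (-s - 1)

lemma uIcc_subset_Ioi_of_pos {a b : ℝ} (ha : 0 < a) (hb : 0 < b) : uIcc a b ⊆ Ioi 0 := by
  intro x hx
  exact (lt_min ha hb).trans_le hx.1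

lemma monotone_measure_ball (μ : Measure ℝ) [IsFiniteMeasure μ] (x : ℝ) :
    Monotone fun ρ => (μ (ball x ρ)).toReal := fun _ _ h =>
  ENNReal.toReal_mono (measure_ne_top _ _) (measure_mono (ball_subset_ball h))

lemma intervalIntegrable_measure_ball (μ : Measure ℝ) [IsFiniteMeasure μ] (s x : ℝ) {a b k : ℝ}
    (hk : 0 ≤ k) (ha : 0 < a) (hb : 0 < b) :
    IntervalIntegrable (fun ρ => (μ (ball x (k * ρ))).toReal * ρ ^ (-s - 1)) volume a b := by
  refine IntervalIntegrable.mul_continuousOn ?_ ?_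
  · exact Monotone.intervalIntegrable fun u v h =>
      monotone_measure_ball μ x (mul_le_mul_of_nonneg_left h hk)
  · intro ρ hρ
    exact (Real.continuousAt_rpow_const _ _
      (Or.inl (uIcc_subset_Ioi_of_pos ha hb hρ).ne')).continuousWithinAt

lemma densityIntegral_add (μ : Measure ℝ) [IsFiniteMeasure μ] (s x : ℝ) {a b c : ℝ}
    (ha : 0 < a) (hb : 0 < b) (hc : 0 < c) :
    densityIntegral μ s x a b + densityIntegral μ s x b c = densityIntegral μ s x a c := by
  have := fun {a b : ℝ} => intervalIntegrable_measure_ball μ s x (a := a) (b := b) zero_le_one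
  simp only [one_mul] at this
  exact intervalIntegral.integral_add_adjacent_intervals (this ha hb) (this hb hc)

lemma densityIntegral_nonneg (μ : Measure ℝ) (s x : ℝ) {a b : ℝ} (ha : 0 < a) (hab : a ≤ b) :
    0 ≤ densityIntegral μ s x a b := by
  refine intervalIntegral.integral_nonneg hab fun ρ hρ => ?_
  have : 0 < ρ := ha.trans_le hρ.1
  positivity

lemma densityIntegral_mul (μ : Measure ℝ) (s x : ℝ) {a b k : ℝ} (hk : 0 < k) (ha : 0 < a)
    (hb : 0 < b) : densityIntegral μ s x (k * a) (k * b) =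
      k ^ (-s) * ∫ ρ in a..b, (μ (ball x (k * ρ))).toReal * ρ ^ (-s - 1) := by
  unfold densityIntegral
  rw [← intervalIntegral.mul_integral_comp_mul_left
    (f := fun ρ => (μ (ball x ρ)).toReal * ρ ^ (-s - 1)),
    ← intervalIntegral.integral_const_mul, ← intervalIntegral.integral_const_mul]
  refine intervalIntegral.integral_congr fun ρ hρ => ?_
  have hρ : 0 < ρ := uIcc_subset_Ioi_of_pos ha hb hρ
  have : k ^ (-s) = k * k ^ (-s - 1) := by
    rw [mul_comm, ← Real.rpow_add_one hk.ne']; congr 1; ring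
  rw [Real.mul_rpow hk.le hρ.le, this]
  ring

namespace ConformalMeasure

variable {ι : Type} {X : Set ℝ} {φ : List ι → ℝ → ℝ} {r : List ι → ℝ} {C s M : ℝ} {μ : Measure ℝ}

lemma densityIntegral_le (hm : ConformalMeasure X φ r C s M μ) {x : ℝ} (hx : x ∈ X) {a b : ℝ}
    (ha : 0 < a) (hab : a ≤ b) : densityIntegral μ s x a b ≤ M * (Real.log b - Real.log a) := by
  have := hm.toIsProbabilityMeasure
  have hb := ha.trans_le hab
  have h1 := intervalIntegrable_measure_ball μ s x zero_le_one ha hb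
  simp only [one_mul] at h1
  rw [← Real.log_div hb.ne' ha.ne', ← integral_inv_of_pos ha hb,
    ← intervalIntegral.integral_const_mul]
  refine intervalIntegral.integral_mono_on hab h1 ?_ fun ρ hρ => ?_
  · refine ContinuousOn.intervalIntegrable fun ρ hρ => ?_
    have := (mem_Ioi.1 (uIcc_subset_Ioi_of_pos ha hb hρ)).ne'
    exact (continuousAt_const.mul (continuousAt_inv₀ this)).continuousWithinAt
  · have hρ0 : 0 < ρ := ha.trans_le hρ.1
    calc (μ (ball x ρ)).toReal * ρ ^ (-s - 1) ≤ M * ρ ^ s * ρ ^ (-s - 1) := by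
          gcongr; exact hm.ball_le x hx ρ hρ0
      _ = M * ρ⁻¹ := by
          rw [mul_assoc, ← Real.rpow_add hρ0, ← Real.rpow_neg_one]; congr 2; ring

lemma abs_densityIntegral_le (hm : ConformalMeasure X φ r C s M μ) {x : ℝ} (hx : x ∈ X) {a b : ℝ}
    (ha : 0 < a) (hb : 0 < b) :
    |densityIntegral μ s x a b| ≤ M * |Real.log b - Real.log a| := by
  rcases le_total a b with hab | hab
  · rw [abs_of_nonneg (densityIntegral_nonneg μ s x ha hab),
      abs_of_nonneg (sub_nonneg.2 (Real.log_le_log ha hab))]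
    exact hm.densityIntegral_le hx ha hab
  · have : densityIntegral μ s x a b = - densityIntegral μ s x b a :=
      intervalIntegral.integral_symm _ _
    rw [this, abs_neg, abs_of_nonneg (densityIntegral_nonneg μ s x hb hab), abs_sub_comm,
      abs_of_nonneg (sub_nonneg.2 (Real.log_le_log hb hab))]
    exact hm.densityIntegral_le hx hb hab

lemma densityIntegral_mul_le (hm : ConformalMeasure X φ r C s M μ) (hs : 0 ≤ s) {x y : ℝ}
    (hy : y ∈ X) {a b k δ : ℝ} (ha : 0 < a) (hab : a ≤ b) (hk : 0 < k) (hδ : 0 ≤ δ)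
    (hxy : ∀ ρ, a ≤ ρ → ρ ≤ b → (μ (ball x (k * ρ))).toReal ≤
      (Real.exp δ * k) ^ s * (μ (ball y (Real.exp δ * ρ))).toReal) :
    densityIntegral μ s x (k * a) (k * b) ≤ densityIntegral μ s y a b + M * δ +
      (Real.exp (2 * s * δ) - 1) * M * (Real.log b - Real.log a) := by
  have := hm.toIsProbabilityMeasure
  have hb := ha.trans_le hab
  have hE := Real.exp_pos δ
  have h1 : densityIntegral μ s x (k * a) (k * b) ≤
      Real.exp (2 * s * δ) * densityIntegral μ s y (Real.exp δ * a) (Real.exp δ * b) := by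
    rw [densityIntegral_mul μ s x hk ha hb, densityIntegral_mul μ s y hE ha hb, ← mul_assoc,
      ← intervalIntegral.integral_const_mul, ← intervalIntegral.integral_const_mul]
    refine intervalIntegral.integral_mono_on hab
      ((intervalIntegrable_measure_ball μ s x hk.le ha hb).const_mul _)
      ((intervalIntegrable_measure_ball μ s y hE.le ha hb).const_mul _) fun ρ hρ => ?_
    have hρ0 : 0 < ρ := ha.trans_le hρ.1
    have e1 : k ^ (-s) * k ^ s = 1 := by rw [← Real.rpow_add hk]; simp
    have e2 : Real.exp (2 * s * δ) * Real.exp δ ^ (-s) = Real.exp δ ^ s := by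
      rw [← Real.exp_mul, ← Real.exp_mul, ← Real.exp_add]; congr 1; ring
    rw [e2, ← mul_assoc, ← mul_assoc]
    refine mul_le_mul_of_nonneg_right ?_ (Real.rpow_nonneg hρ0.le _)
    calc k ^ (-s) * (μ (ball x (k * ρ))).toReal
        ≤ k ^ (-s) * ((Real.exp δ * k) ^ s * (μ (ball y (Real.exp δ * ρ))).toReal) := by
          gcongr; exact hxy ρ hρ.1 hρ.2
      _ = (k ^ (-s) * k ^ s) * (Real.exp δ ^ s * (μ (ball y (Real.exp δ * ρ))).toReal) := by
          rw [Real.mul_rpow hE.le hk.le]; ring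
      _ = _ := by rw [e1, one_mul]
  have hEa : a ≤ Real.exp δ * a := le_mul_of_one_le_left ha.le (Real.one_le_exp hδ)
  have hEb : b ≤ Real.exp δ * b := le_mul_of_one_le_left hb.le (Real.one_le_exp hδ)
  have hEab : Real.exp δ * a ≤ Real.exp δ * b := by gcongr
  have h2 : densityIntegral μ s y (Real.exp δ * a) (Real.exp δ * b) ≤
      densityIntegral μ s y a b + M * δ := by
    have e1 := densityIntegral_add μ s y ha (ha.trans_le hEa) (hb.trans_le hEb)
    have e2 := densityIntegral_add μ s y ha hb (hb.trans_le hEb)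
    have e3 := densityIntegral_nonneg μ s y ha hEa
    have e4 := hm.densityIntegral_le hy hb hEb
    rw [Real.log_mul hE.ne' hb.ne', Real.log_exp, add_sub_cancel_right] at e4
    linarith
  have h3 := hm.densityIntegral_le hy (ha.trans_le hEa) hEab
  rw [Real.log_mul hE.ne' hb.ne', Real.log_mul hE.ne' ha.ne', Real.log_exp,
    add_sub_add_left_eq_sub] at h3
  have h4 : 0 ≤ Real.exp (2 * s * δ) - 1 := by
    have := Real.one_le_exp (show 0 ≤ 2 * s * δ by positivity)
    linarith
  have h5 := mul_le_mul_of_nonneg_left h3 h4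
  nlinarith

lemma exists_exp_sub_one_mul_le (s M : ℝ) {η : ℝ} (hη : 0 < η) :
    ∃ δ > 0, (Real.exp (2 * s * δ) - 1) * M ≤ η := by
  have hc : Continuous fun δ : ℝ => (Real.exp (2 * s * δ) - 1) * M := by fun_prop
  have h0 : ∀ᶠ δ in 𝓝 (0 : ℝ), (Real.exp (2 * s * δ) - 1) * M < η :=
    hc.continuousAt.eventually (gt_mem_nhds (by simpa using hη))
  obtain ⟨δ, h1, h2⟩ := ((h0.filter_mono nhdsWithin_le_nhds).and
    (self_mem_nhdsWithin : Ioi (0 : ℝ) ∈ 𝓝[>] 0)).exists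
  exact ⟨δ, h2, h1.le⟩

/-- Points at distance `O(r)` have comparable density integrals down to scale `r`. -/
lemma densityIntegral_le_of_abs_sub_le (hm : ConformalMeasure X φ r C s M μ) (hs : 0 ≤ s) {η : ℝ}
    (hη : 0 < η) (D : ℝ) : ∃ K, 0 ≤ K ∧ ∀ x ∈ X, ∀ y ∈ X, ∀ t, 0 < t → t ≤ 1 → |x - y| ≤ D * t →
      densityIntegral μ s x t 1 ≤ densityIntegral μ s y t 1 + η * -Real.log t + K := by
  have := hm.toIsProbabilityMeasure
  have hM := hm.nonneg
  obtain ⟨δ, hδ, hδη⟩ := exists_exp_sub_one_mul_le s M hη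
  have hE : 0 < Real.exp δ - 1 := sub_pos.2 (Real.one_lt_exp_iff.2 hδ)
  set R := max 1 (D / (Real.exp δ - 1)) with hR
  have hR1 : 1 ≤ R := le_max_left _ _
  have hR0 : 0 < R := one_pos.trans_le hR1
  have hlogR := Real.log_nonneg hR1
  refine ⟨M * δ + M * Real.log R, by positivity, fun x hx y hy t ht ht1 hxy => ?_⟩
  have hlogt : 0 ≤ -Real.log t := by simpa using Real.log_nonpos ht.le ht1
  have hηt := mul_nonneg hη.le hlogt
  have hMδ := mul_nonneg hM hδ.le
  have h0 := densityIntegral_nonneg μ s y ht ht1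
  rcases le_or_gt (t * R) 1 with h1 | h1
  · have htR : 0 < t * R := by positivity
    have key := hm.densityIntegral_mul_le hs (x := x) hy htR h1 one_pos hδ.le
      (fun ρ hρ _ => by
        have hρ0 : 0 < ρ := htR.trans_le hρ
        have hD : D ≤ (Real.exp δ - 1) * R := by
          rw [mul_comm]; exact (div_le_iff₀ hE).1 (le_max_right _ _)
        have hsub : ball x (1 * ρ) ⊆ ball y (Real.exp δ * ρ) := by
          refine ball_subset_ball' ?_
          rw [Real.dist_eq]
          have : D * t ≤ (Real.exp δ - 1) * ρ := by
            calc D * t ≤ (Real.exp δ - 1) * R * t := by gcongr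
              _ = (Real.exp δ - 1) * (t * R) := by ring
              _ ≤ _ := by gcongr
          linarith
        refine (ENNReal.toReal_mono (measure_ne_top _ _) (measure_mono hsub)).trans ?_
        refine le_mul_of_one_le_left ENNReal.toReal_nonneg (Real.one_le_rpow ?_ hs)
        linarith)
    rw [one_mul, one_mul, Real.log_one, zero_sub] at key
    have e1 := densityIntegral_add μ s x ht htR one_pos
    have e2 := densityIntegral_add μ s y ht htR one_pos
    have htt : t ≤ t * R := le_mul_of_one_le_right ht.le hR1
    have e3 := hm.densityIntegral_le hx ht htt
    have e4 := densityIntegral_nonneg μ s y ht htt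
    rw [Real.log_mul ht.ne' hR0.ne'] at e3 key
    have e5 : (Real.exp (2 * s * δ) - 1) * M * -(Real.log t + Real.log R) ≤ η * -Real.log t := by
      have e6 : 0 ≤ -(Real.log t + Real.log R) := by
        rw [← Real.log_mul ht.ne' hR0.ne']
        simpa using Real.log_nonpos htR.le h1
      refine (mul_le_mul_of_nonneg_right hδη e6).trans ?_
      gcongr
      linarith
    linarith
  · have e1 := hm.densityIntegral_le hx ht ht1
    have e2 : -Real.log t ≤ Real.log R := by
      have := Real.log_nonneg h1.le
      rw [Real.log_mul ht.ne' hR0.ne'] at this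
      linarith
    rw [Real.log_one, zero_sub] at e1
    have := mul_le_mul_of_nonneg_left e2 hM
    linarith

/-- Magnification of cylinders preserves the density integrals up to a small error. -/
lemma abs_densityIntegral_image_sub_le (hm : ConformalMeasure X φ r C s M μ)
    (h : ConformalSystem X φ r C) (hs : 0 ≤ s) {η : ℝ} (hη : 0 < η) :
    ∃ K, 0 ≤ K ∧ ∀ u, ∀ y ∈ X, ∀ t, 0 < t → t ≤ 1 →
      |densityIntegral μ s (φ u y) (r u * t) (r u) - densityIntegral μ s y t 1| ≤
        η * -Real.log t + K := by
  have := hm.toIsProbabilityMeasure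
  have hM := hm.nonneg
  have hC := h.pos
  have hlogC := Real.log_nonneg h.one_le
  obtain ⟨δ, hδ, hδη⟩ := exists_exp_sub_one_mul_le s M hη
  obtain ⟨ρ₁, hρ₁, hsc⟩ := hm.scaling δ hδ
  set ρ₀ := min 1 ρ₁ with hρ₀
  have hρ00 : 0 < ρ₀ := lt_min one_pos hρ₁
  have hρ01 : ρ₀ ≤ 1 := min_le_left _ _
  have hlog0 : 0 ≤ -Real.log ρ₀ := by simpa using Real.log_nonpos hρ00.le hρ01
  refine ⟨M * δ + 2 * M * Real.log C + 2 * (M * -Real.log ρ₀), by positivity,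
    fun u y hy t ht ht1 => ?_⟩
  have hlogt : 0 ≤ -Real.log t := by simpa using Real.log_nonpos ht.le ht1
  have hηt := mul_nonneg hη.le hlogt
  have hMδ := mul_nonneg hM hδ.le
  have hMC := mul_nonneg hM hlogC
  have hM0 := mul_nonneg hM hlog0
  have hr := h.ratio_pos u
  have hrt : 0 < r u * t := by positivity
  have hφ := h.mapsTo u y hy
  rcases le_or_gt t ρ₀ with h1 | h1
  · obtain ⟨lam, hl1, hl2, hsc⟩ := hsc u y hy
    have hlam : 0 < lam := by
      by_contra! hcon
      nlinarith
    have hlt : 0 < lam * t := by positivity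
    have hl0 : 0 < lam * ρ₀ := by positivity
    have up := hm.densityIntegral_mul_le hs (x := φ u y) hy ht h1 hlam hδ.le fun ρ h2 h3 =>
      (hsc ρ (ht.trans_le h2) (h3.trans (min_le_right _ _))).1
    have lo := hm.densityIntegral_mul_le hs (x := y) hφ hlt
      (mul_le_mul_of_nonneg_left h1 hlam.le) (inv_pos.2 hlam) hδ.le fun ρ h2 h3 => by
        have e1 : 0 < lam⁻¹ * ρ := mul_pos (inv_pos.2 hlam) (hlt.trans_le h2)
        have e2 : lam⁻¹ * ρ ≤ ρ₁ := by
          rw [inv_mul_le_iff₀ hlam]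
          exact h3.trans (mul_le_mul_of_nonneg_left (min_le_right _ _) hlam.le)
        have := (hsc _ e1 e2).2
        rwa [div_eq_mul_inv, show lam * (Real.exp δ * (lam⁻¹ * ρ)) = Real.exp δ * ρ by
          field_simp] at this
    rw [inv_mul_cancel_left₀ hlam.ne', inv_mul_cancel_left₀ hlam.ne',
      Real.log_mul hlam.ne' ht.ne', Real.log_mul hlam.ne' hρ00.ne'] at lo
    have e5 : (Real.exp (2 * s * δ) - 1) * M * (Real.log ρ₀ - Real.log t) ≤ η * -Real.log t := by
      have e6 : 0 ≤ Real.log ρ₀ - Real.log t := sub_nonneg.2 (Real.log_le_log ht h1)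
      refine (mul_le_mul_of_nonneg_right hδη e6).trans ?_
      gcongr
      linarith
    rw [add_sub_add_left_eq_sub] at lo
    have a1 := densityIntegral_add μ s y ht hρ00 one_pos
    have a2 := densityIntegral_add μ s (φ u y) hrt hlt hr
    have a3 := densityIntegral_add μ s (φ u y) hlt hl0 hr
    have a4 := densityIntegral_nonneg μ s y hρ00 hρ01
    have a5 := hm.densityIntegral_le hy hρ00 hρ01
    have hlogl : |Real.log lam - Real.log (r u)| ≤ Real.log C := by
      have b1 := Real.log_le_log hr hl1
      have b2 := Real.log_le_log hlam hl2
      rw [Real.log_mul hC.ne' hlam.ne'] at b1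
      rw [Real.log_mul hC.ne' hr.ne'] at b2
      rw [abs_le]; constructor <;> linarith
    have a6 := hm.abs_densityIntegral_le hφ hrt hlt
    have a7 := hm.abs_densityIntegral_le hφ hl0 hr
    rw [Real.log_mul hlam.ne' ht.ne', Real.log_mul hr.ne' ht.ne', add_sub_add_right_eq_sub] at a6
    rw [Real.log_mul hlam.ne' hρ00.ne'] at a7
    have a8 := a6.trans (mul_le_mul_of_nonneg_left hlogl hM)
    have a9 : |densityIntegral μ s (φ u y) (lam * ρ₀) (r u)| ≤
        M * (Real.log C + -Real.log ρ₀) := by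
      refine a7.trans (mul_le_mul_of_nonneg_left ?_ hM)
      have := abs_le.1 hlogl
      rw [abs_le]; constructor <;> linarith
    rw [Real.log_one, zero_sub] at a5
    rw [abs_le] at a8 a9 ⊢
    constructor <;> linarith
  · have e1 := hm.densityIntegral_le hy ht ht1
    have e2 : -Real.log t ≤ -Real.log ρ₀ := neg_le_neg (Real.log_le_log hρ00 h1.le)
    have e3 := mul_le_mul_of_nonneg_left e2 hM
    have hle : r u * t ≤ r u := mul_le_of_le_one_right hr.le ht1
    have e4 := hm.densityIntegral_le hφ hrt hle
    rw [Real.log_mul hr.ne' ht.ne', sub_add_cancel_left] at e4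
    rw [Real.log_one, zero_sub] at e1
    have e5 := densityIntegral_nonneg μ s y ht ht1
    have e6 := densityIntegral_nonneg μ s (φ u y) hrt hle
    rw [abs_le]
    constructor <;> linarith

end ConformalMeasure

lemma lt_of_lt_natCeil_exp {x : ℝ} {n : ℕ} (h : n < ⌈Real.exp x⌉₊) : (n : ℝ) ≤ Real.exp x :=
  (Nat.lt_ceil.1 h).le

/-- A set whose points infinitely often belong to the sets `E n` has small dimension unless
infinitely often `E n` contains many points separated at scale `exp (-n)`. -/
lemma frequently_separated_of_lt_dimH {E : ℕ → Set ℝ} {A : Set ℝ}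
    (hA : ∀ x ∈ A, ∃ᶠ n in atTop, x ∈ E n) {d : ℝ} (hd : 0 ≤ d) (hdA : ENNReal.ofReal d < dimH A)
    {Q : ℝ} (hQ : 0 < Q) (B : ℝ) :
    ∃ᶠ n : ℕ in atTop, ∃ f : ℕ → ℝ, (∀ i < ⌈Real.exp (d * (n + B))⌉₊, f i ∈ E n) ∧
      ∀ i j, i < ⌈Real.exp (d * (n + B))⌉₊ → j < ⌈Real.exp (d * (n + B))⌉₊ → i ≠ j →
        Q * Real.exp (-n) < |f i - f j| := by
  by_contra hcon
  rw [not_frequently] at hcon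
  obtain ⟨n₀, hn₀⟩ := eventually_atTop.1 hcon
  have hcov : ∀ n, ∃ S : Finset ℝ, n₀ ≤ n → (S.card : ℝ) ≤ Real.exp (d * (n + B)) ∧
      E n ⊆ ⋃ x ∈ S, closedBall x (Q * Real.exp (-n)) := by
    intro n
    rcases exists_separated_or_cover (E n) (ρ := Q * Real.exp (-n)) ⌈Real.exp (d * (n + B))⌉₊ with
      ⟨f, h1, h2⟩ | ⟨S, h1, -, h3⟩
    · exact ⟨∅, fun hn => (hn₀ n hn ⟨f, h1, h2⟩).elim⟩
    · exact ⟨S, fun _ => ⟨lt_of_lt_natCeil_exp h1, h3⟩⟩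
  choose S hS using hcov
  obtain ⟨d', hdd', hd'A⟩ := ENNReal.lt_iff_exists_nnreal_btwn.1 hdA
  have hdd : d < d' := by
    rw [← ENNReal.ofReal_coe_nnreal, ENNReal.ofReal_lt_ofReal_iff_of_nonneg hd] at hdd'
    exact hdd'
  have hd'0 : 0 < (d' : ℝ) := hd.trans_lt hdd
  set q := Real.exp (-(d' - d)) with hq
  have hq1 : q < 1 := Real.exp_lt_one_iff.2 (by linarith)
  have hq0 : 0 < q := Real.exp_pos _
  set K := Real.exp (d * B) * (2 * Q) ^ (d' : ℝ) with hK
  have hK0 : 0 < K := by positivity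
  have hlim : Tendsto (fun p : ℕ => ENNReal.ofReal (2 * (Q * Real.exp (-p)))) atTop (𝓝 0) := by
    have h1 : Tendsto (fun p : ℕ => Real.exp (-(p : ℝ))) atTop (𝓝 0) :=
      Real.tendsto_exp_neg_atTop_nhds_zero.comp tendsto_natCast_atTop_atTop
    have := (h1.const_mul Q).const_mul 2
    simpa using ENNReal.tendsto_ofReal this
  have key := Measure.hausdorffMeasure_le_liminf_tsum (d' : ℝ) A (l := atTop)
    (ι := fun p : ℕ => Σ n : ℕ, S (p + n))
    (fun p : ℕ => ENNReal.ofReal (2 * (Q * Real.exp (-p)))) hlim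
    (fun p i => closedBall (i.2 : ℝ) (Q * Real.exp (-((p + i.1 : ℕ) : ℝ))))
    (Eventually.of_forall fun p i => by
      rw [ediam_closedBall_real]
      refine ENNReal.ofReal_le_ofReal ?_
      gcongr
      exact Nat.le_add_right _ _)
    (by
      filter_upwards [eventually_ge_atTop n₀] with p hp x hx
      obtain ⟨n, hn, hxn⟩ := frequently_atTop.1 (hA x hx) p
      obtain ⟨k, rfl⟩ := Nat.exists_eq_add_of_le hn
      obtain ⟨y, hy, hxy⟩ := mem_iUnion₂.1 ((hS (p + k) (hp.trans hn)).2 hxn)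
      exact mem_iUnion.2 ⟨⟨k, ⟨y, hy⟩⟩, hxy⟩)
  have hterm : ∀ n, n₀ ≤ n → ∑ y : S n, ediam (closedBall (y : ℝ) (Q * Real.exp (-n))) ^ (d' : ℝ) ≤
      ENNReal.ofReal (K * q ^ n) := by
    intro n hn
    have h1 : 0 ≤ 2 * (Q * Real.exp (-n)) := by positivity
    simp only [ediam_closedBall_real, Finset.sum_const, Finset.card_univ, Fintype.card_coe,
      nsmul_eq_mul]
    rw [ENNReal.ofReal_rpow_of_nonneg h1 hd'0.le, ← ENNReal.ofReal_natCast,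
      ← ENNReal.ofReal_mul (Nat.cast_nonneg _)]
    refine ENNReal.ofReal_le_ofReal ?_
    calc ((S n).card : ℝ) * (2 * (Q * Real.exp (-n))) ^ (d' : ℝ)
        ≤ Real.exp (d * (n + B)) * (2 * (Q * Real.exp (-n))) ^ (d' : ℝ) := by
          gcongr; exact (hS n hn).1
      _ = K * q ^ n := by
        rw [← mul_assoc 2, Real.mul_rpow (by positivity) (Real.exp_pos _).le, ← Real.exp_mul,
          hq, ← Real.exp_nat_mul, hK]
        have : Real.exp (d * (n + B)) * Real.exp (-n * d') =
            Real.exp (d * B) * Real.exp (n * -(d' - d)) := by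
          rw [← Real.exp_add, ← Real.exp_add]; congr 1; ring
        linear_combination (2 * Q) ^ (d' : ℝ) * this
  have hsum : Summable fun n => K * q ^ n := (summable_geometric_of_lt_one hq0.le hq1).mul_left K
  have hbound : ∀ᶠ p : ℕ in atTop, ∑' i : Σ n : ℕ, S (p + n),
      ediam (closedBall (i.2 : ℝ) (Q * Real.exp (-((p + i.1 : ℕ) : ℝ)))) ^ (d' : ℝ) ≤
        ENNReal.ofReal (∑' n, K * q ^ n) := by
    filter_upwards [eventually_ge_atTop n₀] with p hp
    rw [ENNReal.tsum_sigma', ENNReal.ofReal_tsum_of_nonneg (fun n => by positivity) hsum]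
    refine ENNReal.tsum_le_tsum fun n => ?_
    rw [tsum_fintype]
    refine (hterm (p + n) (by omega)).trans (ENNReal.ofReal_le_ofReal ?_)
    exact mul_le_mul_of_nonneg_left (pow_le_pow_of_le_one hq0.le hq1.le (by omega)) hK0.le
  have hfin : μH[(d' : ℝ)] A ≠ ∞ := by
    refine ne_top_of_le_ne_top (b := ENNReal.ofReal (∑' n, K * q ^ n)) ENNReal.ofReal_ne_top
      (key.trans ((liminf_le_liminf hbound).trans ?_))
    rw [liminf_const]
  exact absurd (dimH_le_of_hausdorffMeasure_ne_top hfin) (not_le.2 hd'A)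

namespace ConformalMeasure

variable {ι : Type} {X : Set ℝ} {φ : List ι → ℝ → ℝ} {r : List ι → ℝ} {C s M : ℝ} {μ : Measure ℝ}

/-- Sets whose lower limit has positive measure contain many separated points. -/
lemma eventually_separated (hm : ConformalMeasure X φ r C s M μ) {E : ℕ → Set ℝ} {A : Set ℝ}
    (hEX : ∀ n, E n ⊆ X) (hA : ∀ x ∈ A, ∀ᶠ n in atTop, x ∈ E n) (hμA : 1 ≤ μ A) {d : ℝ}
    (hds : d < s) {Q : ℝ} (hQ : 0 < Q) (B : ℝ) :
    ∀ᶠ n : ℕ in atTop, ∃ f : ℕ → ℝ, (∀ i < ⌈Real.exp (d * (n + B))⌉₊, f i ∈ E n) ∧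
      ∀ i j, i < ⌈Real.exp (d * (n + B))⌉₊ → j < ⌈Real.exp (d * (n + B))⌉₊ → i ≠ j →
        Q * Real.exp (-n) < |f i - f j| := by
  have := hm.toIsProbabilityMeasure
  have hM := hm.nonneg
  set F : ℕ → Set ℝ := fun n => ⋂ k ≥ n, E k with hF
  have hFmono : Monotone F := fun a b hab => by
    intro x hx
    rw [hF, mem_iInter₂] at hx ⊢
    exact fun k hk => hx k (le_trans hab hk)
  have hU : (1 : ℝ≥0∞) ≤ μ (⋃ n, F n) := by
    refine hμA.trans (measure_mono fun x hx => ?_)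
    obtain ⟨n, hn⟩ := eventually_atTop.1 (hA x hx)
    exact mem_iUnion.2 ⟨n, mem_iInter₂.2 hn⟩
  have hlim := tendsto_measure_iUnion_atTop (μ := μ) hFmono
  have hev : ∀ᶠ n in atTop, (1 / 2 : ℝ≥0∞) < μ (F n) :=
    hlim.eventually (lt_mem_nhds (lt_of_lt_of_le (by simp) hU))
  have hsmall : ∀ᶠ n : ℕ in atTop,
      Real.exp (d * (n + B)) * (M * (2 * (Q * Real.exp (-n))) ^ s) < 1 / 2 := by
    have h1 : Tendsto (fun n : ℕ => Real.exp (-(s - d)) ^ n) atTop (𝓝 0) :=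
      tendsto_pow_atTop_nhds_zero_of_lt_one (Real.exp_pos _).le
        (Real.exp_lt_one_iff.2 (by linarith))
    have h2 := h1.const_mul (Real.exp (d * B) * M * (2 * Q) ^ s)
    rw [mul_zero] at h2
    filter_upwards [h2.eventually (gt_mem_nhds (show (0 : ℝ) < 1 / 2 by norm_num))] with n hn
    refine lt_of_eq_of_lt ?_ hn
    rw [← mul_assoc 2, Real.mul_rpow (by positivity) (Real.exp_pos _).le, ← Real.exp_mul,
      ← Real.exp_nat_mul]
    have : Real.exp (d * (n + B)) * Real.exp (-n * s) =
        Real.exp (d * B) * Real.exp (n * -(s - d)) := by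
      rw [← Real.exp_add, ← Real.exp_add]; congr 1; ring
    linear_combination M * (2 * Q) ^ s * this
  filter_upwards [hev, hsmall] with n hn hn'
  rcases exists_separated_or_cover (E n) (ρ := Q * Real.exp (-n)) ⌈Real.exp (d * (n + B))⌉₊ with
    ⟨f, h1, h2⟩ | ⟨S, h1, h2, h3⟩
  · exact ⟨f, h1, h2⟩
  · exfalso
    have hQn : 0 < Q * Real.exp (-n) := by positivity
    have e1 : μ (F n) ≤ ∑ x ∈ S, ENNReal.ofReal (M * (2 * (Q * Real.exp (-n))) ^ s) := by
      refine (measure_mono ((biInter_subset_of_mem (le_refl n)).trans h3)).trans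
        ((measure_biUnion_finset_le _ _).trans (Finset.sum_le_sum fun x hx => ?_))
      refine (measure_mono (closedBall_subset_ball (show Q * Real.exp (-n) <
        2 * (Q * Real.exp (-n)) by linarith))).trans ?_
      exact (ENNReal.le_ofReal_iff_toReal_le (measure_ne_top _ _) (by positivity)).2
        (hm.ball_le x (hEX n (h2 x hx)) _ (by positivity))
    rw [Finset.sum_const, nsmul_eq_mul, ← ENNReal.ofReal_natCast,
      ← ENNReal.ofReal_mul (Nat.cast_nonneg _)] at e1
    have e2 : ENNReal.ofReal (S.card * (M * (2 * (Q * Real.exp (-n))) ^ s)) ≤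
        ENNReal.ofReal (1 / 2) := by
      refine ENNReal.ofReal_le_ofReal (le_trans ?_ hn'.le)
      gcongr
      exact lt_of_lt_natCeil_exp h1
    have e3 : ENNReal.ofReal (1 / 2) = 1 / 2 := by
      rw [ENNReal.ofReal_div_of_pos two_pos]; simp
    rw [e3] at e2
    exact absurd (hn.trans_le (e1.trans e2)) (lt_irrefl _)

end ConformalMeasure

/-- Any sequence can be slowed down so that it grows sublinearly. -/
lemma exists_slow_schedule (n : ℕ → ℕ) :
    ∃ J : ℕ → ℕ, Tendsto J atTop atTop ∧ ∀ K : ℕ, ∀ᶠ k in atTop, K * n (J k) ≤ k := by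
  set J : ℕ → ℕ := fun k => Nat.findGreatest (fun j => j * n j ≤ k) k with hJ
  have hspec : ∀ k, J k * n (J k) ≤ k := fun k =>
    Nat.findGreatest_spec (P := fun j => j * n j ≤ k) (Nat.zero_le k) (by simp)
  have hlim : Tendsto J atTop atTop := by
    refine tendsto_atTop.2 fun j => ?_
    filter_upwards [eventually_ge_atTop (max j (j * n j))] with k hk
    exact Nat.le_findGreatest ((le_max_left _ _).trans hk) ((le_max_right _ _).trans hk)
  refine ⟨J, hlim, fun K => ?_⟩
  filter_upwards [hlim.eventually_ge_atTop K] with k hk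
  exact (Nat.mul_le_mul_right _ hk).trans (hspec k)

/-- A sequence which does not increase much when it is large and has small jumps is small. -/
lemma eventually_le_mul_of_controlled {D T : ℕ → ℝ} (hT : Monotone T) (hT0 : ∀ k, 0 ≤ T k)
    (hTlim : Tendsto T atTop atTop)
    (h1 : ∀ η > 0, ∀ᶠ k in atTop, η * T k < D k → D (k + 1) ≤ D k + η * (T (k + 1) - T k))
    (h2 : ∀ η > 0, ∀ᶠ k in atTop, D (k + 1) - D k ≤ η * T k) {η : ℝ} (hη : 0 < η) :
    ∀ᶠ k in atTop, D k ≤ η * T k := by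
  obtain ⟨k₀, hk₀⟩ := eventually_atTop.1 ((h1 (η / 4) (by positivity)).and
    (h2 (η / 4) (by positivity)))
  set A := max (D k₀) 0 with hA
  have hA0 : 0 ≤ A := le_max_right _ _
  have key : ∀ k, k₀ ≤ k → D k ≤ A + η / 2 * T k := by
    intro k hk
    induction k, hk using Nat.le_induction with
    | base =>
      have := le_max_left (D k₀) 0
      have := mul_nonneg (half_pos hη).le (hT0 k₀)
      linarith
    | succ k hk ih =>
      obtain ⟨e1, e2⟩ := hk₀ k hk
      have e3 := sub_nonneg.2 (hT (Nat.le_succ k))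
      have e4 := mul_nonneg hη.le e3
      rcases lt_or_ge (η / 4 * T k) (D k) with h | h
      · have := e1 h
        simp only [Nat.succ_eq_add_one] at *
        linarith
      · have := hT0 k
        simp only [Nat.succ_eq_add_one] at *
        linarith
  filter_upwards [eventually_ge_atTop k₀, hTlim.eventually_ge_atTop (A / (η / 2))] with k hk hk'
  have e1 := key k hk
  rw [div_le_iff₀ (half_pos hη)] at hk'
  linarith

namespace ConformalMeasure

variable {ι : Type} {X : Set ℝ} {φ : List ι → ℝ → ℝ} {r : List ι → ℝ} {C s M : ℝ} {μ : Measure ℝ}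

/-- If along a sequence of scales the excess of the density integral is steered towards zero, then
the average density exists. -/
lemma tendsto_avgA_of_steered (hm : ConformalMeasure X φ r C s M μ) {x : ℝ} (hx : x ∈ X)
    {α B : ℝ} {ρ n D' : ℕ → ℝ} (hρ0 : ∀ k, 0 < ρ k) (hρ1 : ∀ k, ρ k ≤ 1) (hn1 : ∀ k, 1 ≤ n k)
    (hlo : ∀ k, n k / 2 ≤ Real.log (ρ k) - Real.log (ρ (k + 1)))
    (hup : ∀ k, Real.log (ρ k) - Real.log (ρ (k + 1)) ≤ B * n k)
    (hn : ∀ η > 0, ∀ᶠ k : ℕ in atTop, n k ≤ η * k)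
    (hD' : ∀ η > 0, ∃ K, ∀ k, |densityIntegral μ s x (ρ k) 1 - α * -Real.log (ρ k) - D' k| ≤
      η * -Real.log (ρ k) + K)
    (hpos : ∀ η > 0, ∀ᶠ k in atTop, 0 < D' k → densityIntegral μ s x (ρ (k + 1)) (ρ k) -
      α * (Real.log (ρ k) - Real.log (ρ (k + 1))) ≤ η * n k)
    (hneg : ∀ η > 0, ∀ᶠ k in atTop, D' k ≤ 0 → -(η * n k) ≤
      densityIntegral μ s x (ρ (k + 1)) (ρ k) - α * (Real.log (ρ k) - Real.log (ρ (k + 1)))) :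
    Tendsto (avgA μ s x) (𝓝[>] 0) (𝓝 α) := by
  have := hm.toIsProbabilityMeasure
  have hM := hm.nonneg
  set T : ℕ → ℝ := fun k => -Real.log (ρ k) with hTdef
  have hT0 : ∀ k, 0 ≤ T k := fun k => by simpa [hTdef] using Real.log_nonpos (hρ0 k).le (hρ1 k)
  have hTlo : ∀ k, n k / 2 ≤ T (k + 1) - T k := fun k => by
    have := hlo k; simp only [hTdef]; linarith
  have hTup : ∀ k, T (k + 1) - T k ≤ B * n k := fun k => by
    have := hup k; simp only [hTdef]; linarith
  have hTmono : Monotone T := monotone_nat_of_le_succ fun k => by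
    have := hTlo k; have := hn1 k; linarith
  have hTk : ∀ k : ℕ, (k : ℝ) / 2 ≤ T k := by
    intro k
    induction k with
    | zero => simpa using hT0 0
    | succ k ih =>
      have := hTlo k; have := hn1 k
      push_cast
      linarith
  have hTlim : Tendsto T atTop atTop := by
    refine tendsto_atTop_mono hTk ?_
    exact tendsto_natCast_atTop_atTop.atTop_div_const two_pos
  have hB : 0 < B := by
    have e1 := hTlo 0; have e2 := hTup 0; have e3 := hn1 0
    by_contra! hcon
    nlinarith
  set D : ℕ → ℝ := fun k => densityIntegral μ s x (ρ k) 1 - α * T k with hDdef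
  have hstep : ∀ k, D (k + 1) - D k = densityIntegral μ s x (ρ (k + 1)) (ρ k) -
      α * (Real.log (ρ k) - Real.log (ρ (k + 1))) := fun k => by
    have := densityIntegral_add μ s x (hρ0 (k + 1)) (hρ0 k) one_pos
    simp only [hDdef, hTdef]; linarith
  have hnT : ∀ η > 0, ∀ᶠ k in atTop, n k ≤ η * T k := by
    intro η hη
    filter_upwards [hn (η / 2) (half_pos hη)] with k hk
    have := mul_le_mul_of_nonneg_left (hTk k) hη.le
    linarith
  have hjump : ∀ η > 0, ∀ᶠ k in atTop, |D (k + 1) - D k| ≤ η * T k := by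
    intro η hη
    have hpos : 0 < (M + |α|) * B + 1 := by positivity
    filter_upwards [hnT (η / ((M + |α|) * B + 1)) (by positivity)] with k hk
    rw [hstep]
    have e0 : 0 ≤ Real.log (ρ k) - Real.log (ρ (k + 1)) := by
      have := hlo k; have := hn1 k; linarith
    have e1 := hm.abs_densityIntegral_le hx (hρ0 (k + 1)) (hρ0 k)
    rw [abs_of_nonneg e0] at e1
    refine (abs_sub _ _).trans ?_
    rw [abs_mul, abs_of_nonneg e0]
    rw [div_mul_eq_mul_div, le_div_iff₀ hpos] at hk
    have e2 := mul_le_mul_of_nonneg_left (hup k) (add_nonneg hM (abs_nonneg α))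
    have := hn1 k
    linarith
  have hclose : ∀ η > 0, ∀ᶠ k in atTop, |D k - D' k| < η * T k := by
    intro η hη
    obtain ⟨K, hK⟩ := hD' (η / 2) (half_pos hη)
    filter_upwards [hTlim.eventually_gt_atTop (K / (η / 2))] with k hk
    rw [div_lt_iff₀ (half_pos hη)] at hk
    have := hK k
    simp only [hDdef, hTdef] at *
    linarith
  have hsmall : ∀ η > 0, ∀ᶠ k in atTop, |D k| ≤ η * T k := by
    intro η hη
    have b1 := eventually_le_mul_of_controlled (D := D) hTmono hT0 hTlim
      (fun η hη => by
        filter_upwards [hclose η hη, hpos (η / 2) (half_pos hη)] with k h1 h2 h3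
        have e1 := h2 (by have := (abs_lt.1 h1).2; linarith)
        rw [← hstep] at e1
        have := mul_le_mul_of_nonneg_left (hTlo k) hη.le
        linarith)
      (fun η hη => (hjump η hη).mono fun k hk => (abs_le.1 hk).2) hη
    have b2 := eventually_le_mul_of_controlled (D := fun k => -D k) hTmono hT0 hTlim
      (fun η hη => by
        filter_upwards [hclose η hη, hneg (η / 2) (half_pos hη)] with k h1 h2 h3
        have e1 := h2 (by have := (abs_lt.1 h1).1; linarith)
        rw [← hstep] at e1
        have := mul_le_mul_of_nonneg_left (hTlo k) hη.le
        linarith)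
      (fun η hη => (hjump η hη).mono fun k hk => by
        have := (abs_le.1 hk).1
        linarith) hη
    filter_upwards [b1, b2] with k h1 h2
    rw [abs_le]; constructor <;> linarith
  rw [Metric.tendsto_nhds]
  intro ε hε
  have hpos' : 0 < (M + |α|) * B + 1 := by positivity
  obtain ⟨k₀, hk₀⟩ := eventually_atTop.1 ((hsmall (ε / 4) (by positivity)).and
    (hnT (ε / 4 / ((M + |α|) * B + 1)) (by positivity)))
  have hnear : ∀ᶠ t in 𝓝[>] (0 : ℝ), t ∈ Ioo 0 (min (ρ k₀) (1 / 2)) :=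
    Ioo_mem_nhdsGT (lt_min (hρ0 _) (by norm_num))
  filter_upwards [hnear] with t ht
  have ht0 := ht.1
  have htρ : t < ρ k₀ := ht.2.trans_le (min_le_left _ _)
  have ht1 : t < 1 := ht.2.trans_le ((min_le_right _ _).trans (by norm_num))
  set L := -Real.log t with hL
  have hL0 : 0 < L := neg_pos.2 (Real.log_neg ht0 ht1)
  have hex : ∃ k, L < T (k₀ + k) := by
    obtain ⟨k, hk, hk'⟩ := ((hTlim.eventually_gt_atTop L).and (eventually_ge_atTop k₀)).exists
    obtain ⟨j, rfl⟩ := Nat.exists_eq_add_of_le hk'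
    exact ⟨j, hk⟩
  classical
  obtain ⟨j, hj, hj'⟩ : ∃ j, T (k₀ + j) ≤ L ∧ L < T (k₀ + j + 1) := by
    have hne : Nat.find hex ≠ 0 := by
      intro h0
      have e1 := Nat.find_spec hex
      rw [h0, add_zero] at e1
      have := Real.log_lt_log ht0 htρ
      simp only [hL, hTdef] at e1
      linarith
    obtain ⟨j, hj⟩ := Nat.exists_eq_succ_of_ne_zero hne
    refine ⟨j, ?_, ?_⟩
    · exact not_lt.1 (Nat.find_min hex (by omega))
    · have := Nat.find_spec hex
      rwa [hj] at this
  obtain ⟨c1, c2⟩ := hk₀ (k₀ + j) (Nat.le_add_right _ _)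
  set k := k₀ + j
  have d1 := densityIntegral_add μ s x ht0 (hρ0 k) one_pos
  have d2 := hm.abs_densityIntegral_le hx ht0 (hρ0 k)
  have d3 : |Real.log (ρ k) - Real.log t| ≤ B * n k := by
    have := hTup k
    have : Real.log (ρ k) - Real.log t = L - T k := by simp only [hL, hTdef]; ring
    rw [this, abs_of_nonneg (by linarith)]
    linarith
  have d4 : |densityIntegral μ s x t 1 - α * L| ≤ ε / 2 * L := by
    have e1 : densityIntegral μ s x t 1 - α * L =
        D k + (densityIntegral μ s x t (ρ k) - α * (Real.log (ρ k) - Real.log t)) := by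
      simp only [hDdef, hTdef, hL]; linarith
    have e2 : |densityIntegral μ s x t (ρ k) - α * (Real.log (ρ k) - Real.log t)| ≤
        (M + |α|) * (B * n k) := by
      refine (abs_sub _ _).trans ?_
      rw [abs_mul]
      have f1 := mul_le_mul_of_nonneg_left d3 hM
      have f2 := mul_le_mul_of_nonneg_left d3 (abs_nonneg α)
      linarith
    rw [div_mul_eq_mul_div, le_div_iff₀ hpos'] at c2
    have e3 := hn1 k
    have e4 := mul_le_mul_of_nonneg_left hj hε.le
    rw [e1]
    refine (abs_add_le _ _).trans ?_
    linarith
  have e5 : avgA μ s x t - α = (densityIntegral μ s x t 1 - α * L) / L := by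
    rw [sub_div, mul_div_cancel_right₀ _ hL0.ne']
    unfold avgA densityIntegral
    rw [one_div_mul_eq_div]
  rw [Real.dist_eq, e5, abs_div, abs_of_pos hL0, div_lt_iff₀ hL0]
  have := mul_pos hε hL0
  linarith

end ConformalMeasure

lemma exists_forall_le_add_of_eventually_le {a b : ℕ → ℝ} (h : ∀ᶠ k in atTop, a k ≤ b k) :
    ∃ K, ∀ k, a k ≤ b k + K := by
  obtain ⟨k₀, hk₀⟩ := eventually_atTop.1 h
  refine ⟨∑ i ∈ Finset.range k₀, |a i - b i|, fun k => ?_⟩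
  rcases lt_or_ge k k₀ with hk | hk
  · have h1 := Finset.single_le_sum (f := fun i => |a i - b i|) (fun i _ => abs_nonneg _)
      (Finset.mem_range.2 hk)
    have h2 := le_abs_self (a k - b k)
    linarith
  · have h1 : 0 ≤ ∑ i ∈ Finset.range k₀, |a i - b i| := Finset.sum_nonneg fun i _ => abs_nonneg _
    have := hk₀ k hk
    linarith

namespace ConformalSystem

variable {ι : Type} {X : Set ℝ} {φ : List ι → ℝ → ℝ} {r : List ι → ℝ} {C s M : ℝ} {μ : Measure ℝ}

lemma log_ratio_append (h : ConformalSystem X φ r C) (u : List ι) {w : List ι} {n : ℝ}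
    (h1 : r w ≤ Real.exp (-n)) (h2 : Real.exp (-n) ≤ C * r w) :
    n - Real.log C ≤ Real.log (r u) - Real.log (r (u ++ w)) ∧
      Real.log (r u) - Real.log (r (u ++ w)) ≤ n + 2 * Real.log C := by
  have hC := h.pos
  have hu := h.ratio_pos u
  have hw := h.ratio_pos w
  have huw := h.ratio_pos (u ++ w)
  have e1 := Real.log_le_log hw h1
  have e2 := Real.log_le_log (Real.exp_pos _) h2
  have e3 := Real.log_le_log huw (h.ratio_append_le u w)
  have e4 := Real.log_le_log (mul_pos hu hw) (h.le_ratio_append u w)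
  rw [Real.log_exp] at e1 e2
  rw [Real.log_mul hC.ne' hw.ne'] at e2
  rw [Real.log_mul hC.ne' (mul_pos hu hw).ne', Real.log_mul hu.ne' hw.ne'] at e3
  rw [Real.log_mul hC.ne' huw.ne', Real.log_mul hu.ne' hw.ne'] at e4
  constructor <;> linarith

/-- The excess of the density integral over a long word is determined by any of its points. -/
lemma abs_excess_sub_le (h : ConformalSystem X φ r C) (hm : ConformalMeasure X φ r C s M μ)
    (hs : 0 ≤ s) (α : ℝ) {η : ℝ} (hη : 0 < η) :
    ∀ᶠ n : ℕ in atTop, ∀ w, r w ≤ Real.exp (-n) → Real.exp (-n) ≤ C * r w → ∀ f ∈ φ w '' X,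
      ∀ u, ∀ x ∈ φ (u ++ w) '' X,
        |densityIntegral μ s x (r (u ++ w)) (r u) - α * (Real.log (r u) - Real.log (r (u ++ w))) -
          (densityIntegral μ s f (Real.exp (-n)) 1 - α * n)| ≤ η * n := by
  have := hm.toIsProbabilityMeasure
  have hM := hm.nonneg
  have hlogC := Real.log_nonneg h.one_le
  obtain ⟨K₁, hK₁, hB⟩ := hm.abs_densityIntegral_image_sub_le h hs
    (show 0 < η / 4 by positivity)
  obtain ⟨K₂, hK₂, hD⟩ := hm.densityIntegral_le_of_abs_sub_le hs
    (show 0 < η / 4 by positivity) (C ^ 2)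
  set K := K₁ + K₂ + M * (2 * Real.log C) + |α| * (2 * Real.log C)
  have hlarge : ∀ᶠ n : ℕ in atTop, K / (η / 2) ≤ n :=
    tendsto_natCast_atTop_atTop.eventually_ge_atTop _
  filter_upwards [hlarge] with n hn w hw1 hw2 f hf u x hx
  rw [div_le_iff₀ (half_pos hη)] at hn
  have ht0 := Real.exp_pos (-(n : ℝ))
  have ht1 : Real.exp (-(n : ℝ)) ≤ 1 := Real.exp_le_one_iff.2 (by simp)
  obtain ⟨x, hx, rfl⟩ := hx
  rw [h.append]
  set y := φ w x
  have hy : y ∈ φ w '' X := mem_image_of_mem _ hx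
  have hyX := h.image_subset w hy
  have hfX := h.image_subset w hf
  have hlt : C ^ 2 * r w ≤ C ^ 2 * Real.exp (-n) := by gcongr
  have a1 := hB u y hyX _ ht0 ht1
  have a2 := hD y hyX f hfX _ ht0 ht1 ((h.abs_sub_le_of_mem hy hf).trans hlt)
  have a3 := hD f hfX y hyX _ ht0 ht1 ((h.abs_sub_le_of_mem hf hy).trans hlt)
  obtain ⟨b1, b2⟩ := h.log_ratio_append u hw1 hw2
  have hu := h.ratio_pos u
  have hut : 0 < r u * Real.exp (-n) := by positivity
  have a4 := densityIntegral_add μ s (φ u y) (h.ratio_pos (u ++ w)) hut hu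
  have a5 := hm.abs_densityIntegral_le (h.mapsTo u y hyX) (h.ratio_pos (u ++ w)) hut
  rw [Real.log_mul hu.ne' ht0.ne', Real.log_exp] at a5
  rw [Real.log_exp, neg_neg] at a1 a2 a3
  have b3 : |Real.log (r u) + -(n : ℝ) - Real.log (r (u ++ w))| ≤ 2 * Real.log C := by
    rw [abs_le]; constructor <;> linarith
  have a6 := a5.trans (mul_le_mul_of_nonneg_left b3 hM)
  have a7 : |α * (Real.log (r u) + -(n : ℝ) - Real.log (r (u ++ w)))| ≤
      |α| * (2 * Real.log C) := by
    rw [abs_mul]; exact mul_le_mul_of_nonneg_left b3 (abs_nonneg α)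
  rw [abs_le] at a1 a6 a7 ⊢
  have e : α * (Real.log (r u) + -(n : ℝ) - Real.log (r (u ++ w))) =
    α * (Real.log (r u) - Real.log (r (u ++ w))) - α * n := by ring
  rw [e] at a7
  constructor <;> linarith [a1.1, a1.2, a6.1, a6.2, a7.1, a7.2]

/-- If at infinitely many scales there are many points with too small and many points with too
large density integrals, then the level set of the average density is large. -/
theorem le_dimH_level_set (h : ConformalSystem X φ r C) (hm : ConformalMeasure X φ r C s M μ)
    (hXc : IsCompact X) (hXne : X.Nonempty) (hs : 0 ≤ s) {α d e : ℝ} (he : 0 < e) (hed : e < d)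
    (hfam : ∀ η > 0, ∃ᶠ n : ℕ in atTop,
      (∃ f : ℕ → ℝ, (∀ i < ⌈Real.exp (d * (n + 2 * Real.log C))⌉₊,
          f i ∈ {x ∈ X | densityIntegral μ s x (Real.exp (-n)) 1 ≤ (α + η) * n}) ∧
        ∀ i j, i < ⌈Real.exp (d * (n + 2 * Real.log C))⌉₊ →
          j < ⌈Real.exp (d * (n + 2 * Real.log C))⌉₊ → i ≠ j →
          (2 * C ^ 2 + 1) * Real.exp (-n) < |f i - f j|) ∧
      (∃ f : ℕ → ℝ, (∀ i < ⌈Real.exp (d * (n + 2 * Real.log C))⌉₊,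
          f i ∈ {x ∈ X | (α - η) * n ≤ densityIntegral μ s x (Real.exp (-n)) 1}) ∧
        ∀ i j, i < ⌈Real.exp (d * (n + 2 * Real.log C))⌉₊ →
          j < ⌈Real.exp (d * (n + 2 * Real.log C))⌉₊ → i ≠ j →
          (2 * C ^ 2 + 1) * Real.exp (-n) < |f i - f j|)) :
    ENNReal.ofReal e ≤ dimH {x ∈ X | Tendsto (avgA μ s x) (𝓝[>] 0) (𝓝 α)} := by
  have hC := h.pos
  have hlogC := Real.log_nonneg h.one_le
  have hd : 0 < d := he.trans hed
  have hwords : ∀ j : ℕ, ∃ (n : ℕ) (W V : ℕ → List ι), j + 1 ≤ n ∧ 2 * Real.log C ≤ n ∧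
      (∀ i < ⌈Real.exp (d * (n + 2 * Real.log C))⌉₊,
        (r (W i) ≤ Real.exp (-n) ∧ Real.exp (-n) ≤ C * r (W i)) ∧
        ∀ u, ∀ x ∈ φ (u ++ W i) '' X, densityIntegral μ s x (r (u ++ W i)) (r u) -
          α * (Real.log (r u) - Real.log (r (u ++ W i))) ≤ 1 / (j + 1 : ℝ) * n) ∧
      (∀ i i', i < ⌈Real.exp (d * (n + 2 * Real.log C))⌉₊ →
        i' < ⌈Real.exp (d * (n + 2 * Real.log C))⌉₊ → i ≠ i' →
        ∀ x ∈ φ (W i) '' X, ∀ y ∈ φ (W i') '' X, Real.exp (-n) ≤ |x - y|) ∧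
      (∀ i < ⌈Real.exp (d * (n + 2 * Real.log C))⌉₊,
        (r (V i) ≤ Real.exp (-n) ∧ Real.exp (-n) ≤ C * r (V i)) ∧
        ∀ u, ∀ x ∈ φ (u ++ V i) '' X, -(1 / (j + 1 : ℝ) * n) ≤
          densityIntegral μ s x (r (u ++ V i)) (r u) -
            α * (Real.log (r u) - Real.log (r (u ++ V i)))) ∧
      (∀ i i', i < ⌈Real.exp (d * (n + 2 * Real.log C))⌉₊ →
        i' < ⌈Real.exp (d * (n + 2 * Real.log C))⌉₊ → i ≠ i' →
        ∀ x ∈ φ (V i) '' X, ∀ y ∈ φ (V i') '' X, Real.exp (-n) ≤ |x - y|) := by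
    intro j
    set η : ℝ := 1 / (j + 1) / 2 with hη
    have hη0 : 0 < η := by positivity
    have hη2 : 1 / (j + 1 : ℝ) = 2 * η := by rw [hη]; ring
    have hlarge : ∀ᶠ n : ℕ in atTop, 2 * Real.log C ≤ n :=
      tendsto_natCast_atTop_atTop.eventually_ge_atTop _
    obtain ⟨n, ⟨⟨f, hf, hfsep⟩, f', hf', hfsep'⟩, hex, hnj, hnC⟩ :=
      ((hfam η hη0).and_eventually ((h.abs_excess_sub_le hm hs α hη0).and
        ((eventually_ge_atTop (j + 1)).and hlarge))).exists
    have ht1 : Real.exp (-(n : ℝ)) ≤ 1 := Real.exp_le_one_iff.2 (by simp)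
    obtain ⟨W, hW, hWsep⟩ := h.exists_separated_cylinders (Real.exp_pos _) ht1
      (fun i hi => (hf i hi).1) hfsep
    obtain ⟨V, hV, hVsep⟩ := h.exists_separated_cylinders (Real.exp_pos _) ht1
      (fun i hi => (hf' i hi).1) hfsep'
    refine ⟨n, W, V, hnj, hnC, fun i hi => ⟨(hW i hi).2, fun u x hx => ?_⟩, hWsep,
      fun i hi => ⟨(hV i hi).2, fun u x hx => ?_⟩, hVsep⟩
    · have e1 := hex (W i) (hW i hi).2.1 (hW i hi).2.2 (f i) (hW i hi).1 u x hx
      have e2 := (hf i hi).2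
      have e3 := (abs_le.1 e1).2
      rw [hη2]
      linarith
    · have e1 := hex (V i) (hV i hi).2.1 (hV i hi).2.2 (f' i) (hV i hi).1 u x hx
      have e2 := (hf' i hi).2
      have e3 := (abs_le.1 e1).1
      rw [hη2]
      linarith
  choose n W V hnj hnC hW hWsep hV hVsep using hwords
  obtain ⟨J, hJ, hJn⟩ := exists_slow_schedule n
  have hn1 : ∀ j, (1 : ℝ) ≤ n j := fun j => by
    exact_mod_cast (Nat.le_add_left 1 j).trans (hnj j)
  have hno : ∀ η > 0, ∀ᶠ k : ℕ in atTop, (n (J k) : ℝ) ≤ η * k := by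
    intro η hη
    obtain ⟨K, hK⟩ := exists_nat_gt (1 / η)
    filter_upwards [hJn K] with k hk
    have e1 : (K : ℝ) * n (J k) ≤ k := by exact_mod_cast hk
    rw [div_lt_iff₀ hη] at hK
    have e2 := hn1 (J k)
    nlinarith
  obtain ⟨x₀, hx₀⟩ := hXne
  set test : List ι → ℝ := fun u =>
    densityIntegral μ s (φ u x₀) (r u) 1 - α * -Real.log (r u) with htest
  classical
  set m : ℕ → ℝ := fun k => Real.log (C ^ 2 / Real.exp (-(n (J k) : ℝ))) with hmdef
  have hmn : ∀ k, m k = n (J k) + 2 * Real.log C := fun k => by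
    simp only [hmdef]
    rw [Real.log_div (by positivity) (Real.exp_pos _).ne', Real.log_exp, Real.log_pow]
    push_cast; ring
  have hm1 : ∀ k, 1 ≤ m k := fun k => by rw [hmn]; linarith [hn1 (J k)]
  set child : ℕ → List ι → ℕ → List ι := fun k u i => if 0 < test u then W (J k) i else V (J k) i
    with hchild
  have hchildr : ∀ k u i, i < ⌈Real.exp (d * (n (J k) + 2 * Real.log C))⌉₊ →
      r (child k u i) ≤ Real.exp (-(n (J k) : ℝ)) ∧
        Real.exp (-(n (J k) : ℝ)) ≤ C * r (child k u i) := by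
    intro k u i hi
    simp only [hchild]
    split_ifs
    · exact (hW _ i hi).1
    · exact (hV _ i hi).1
  have hgrow : ∃ K', ∀ k, e * (∑ i ∈ Finset.range k, m i + m k) ≤
      d * ∑ i ∈ Finset.range k, m i + K' := by
    refine exists_forall_le_add_of_eventually_le ?_
    have hc : 0 < e * (1 + 2 * Real.log C) := by positivity
    filter_upwards [hno ((d - e) / (e * (1 + 2 * Real.log C)))
      (div_pos (sub_pos.2 hed) hc)] with k hk
    have e1 : (k : ℝ) ≤ ∑ i ∈ Finset.range k, m i := by
      have := Finset.card_nsmul_le_sum (Finset.range k) m 1 fun i _ => hm1 i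
      simpa using this
    have e2 := mul_le_mul_of_nonneg_left e1 (sub_pos.2 hed).le
    rw [div_mul_eq_mul_div, le_div_iff₀ hc] at hk
    have e3 : e * m k ≤ n (J k) * (e * (1 + 2 * Real.log C)) := by
      rw [hmn]
      have := mul_le_mul_of_nonneg_left (hn1 (J k)) (mul_nonneg he.le hlogC)
      linarith
    linarith
  obtain ⟨K', hgrow⟩ := hgrow
  refine (h.le_dimH_moran hXc ⟨x₀, hx₀⟩
    (N := fun k => ⌈Real.exp (d * (n (J k) + 2 * Real.log C))⌉₊) (m := m) (child := child)
    he hC ?_ ?_ ?_ ?_ hgrow).trans (dimH_mono ?_)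
  · intro k
    refine Nat.lt_ceil.2 ?_
    rw [Nat.cast_one, Real.one_lt_exp_iff]
    have := hn1 (J k)
    positivity
  · intro k
    rw [hmn]
    exact Nat.le_ceil _
  · intro k u i hi
    exact (h.ratio_append_ge u (hchildr k u i hi).2).resolve_right (not_le.2 (Real.exp_pos _))
  · intro k u i j hi hj hij
    refine h.separated_append (Real.exp_pos _) u ?_
    simp only [hchild]
    split_ifs
    · exact hWsep _ i j hi hj hij
    · exact hVsep _ i j hi hj hij
  · rintro x ⟨hxX, u, -, hu, hxu⟩
    refine ⟨hxX, ?_⟩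
    have hlog : ∀ k, n (J k) - Real.log C ≤ Real.log (r (u k)) - Real.log (r (u (k + 1))) ∧
        Real.log (r (u k)) - Real.log (r (u (k + 1))) ≤ n (J k) + 2 * Real.log C := by
      intro k
      obtain ⟨i, hi, hk⟩ := hu k
      have e1 := hchildr k (u k) i hi
      rw [hk]
      exact h.log_ratio_append (u k) e1.1 e1.2
    have hinv : ∀ η > 0, ∀ᶠ k in atTop, 1 / ((J k : ℝ) + 1) ≤ η := by
      intro η hη
      obtain ⟨K, hK⟩ := exists_nat_gt (1 / η)
      filter_upwards [hJ.eventually_ge_atTop K] with k hk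
      have e1 : (K : ℝ) ≤ J k := by exact_mod_cast hk
      rw [div_le_iff₀ (by positivity)]
      rw [div_lt_iff₀ hη] at hK
      nlinarith
    refine hm.tendsto_avgA_of_steered hxX (ρ := fun k => r (u k)) (n := fun k => n (J k))
      (D' := fun k => test (u k)) (B := 1 + 2 * Real.log C) (fun k => h.ratio_pos _)
      (fun k => h.ratio_le_one _) (fun k => hn1 _) (fun k => ?_) (fun k => ?_) hno ?_ ?_ ?_
    · have := (hlog k).1
      have := hnC (J k)
      linarith
    · have := (hlog k).2
      have := mul_le_mul_of_nonneg_left (hn1 (J k)) hlogC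
      linarith
    · intro η hη
      obtain ⟨K, hK, hD⟩ := hm.densityIntegral_le_of_abs_sub_le hs hη (C ^ 2)
      refine ⟨K, fun k => ?_⟩
      have hxk := hxu k
      have hx0 : φ (u k) x₀ ∈ φ (u k) '' X := mem_image_of_mem _ hx₀
      have e1 := hD x hxX _ (h.mapsTo _ _ hx₀) (r (u k)) (h.ratio_pos _) (h.ratio_le_one _)
        (h.abs_sub_le_of_mem hxk hx0)
      have e2 := hD _ (h.mapsTo _ _ hx₀) x hxX (r (u k)) (h.ratio_pos _) (h.ratio_le_one _)
        (h.abs_sub_le_of_mem hx0 hxk)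
      simp only [htest]
      rw [abs_le]
      constructor <;> linarith
    · intro η hη
      filter_upwards [hinv η hη] with k hk hpos
      obtain ⟨i, hi, hki⟩ := hu k
      have hxk := hxu (k + 1)
      have hc : child k (u k) i = W (J k) i := if_pos hpos
      rw [hc] at hki
      rw [hki] at hxk ⊢
      refine ((hW (J k) i hi).2 (u k) x hxk).trans ?_
      have := hn1 (J k)
      gcongr
    · intro η hη
      filter_upwards [hinv η hη] with k hk hneg
      obtain ⟨i, hi, hki⟩ := hu k
      have hxk := hxu (k + 1)
      have hc : child k (u k) i = V (J k) i := if_neg (not_lt.2 hneg)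
      rw [hc] at hki
      rw [hki] at hxk ⊢
      refine le_trans ?_ ((hV (J k) i hi).2 (u k) x hxk)
      have := hn1 (J k)
      gcongr

end ConformalSystem

lemma densityIntegral_eq_avgA_mul (μ : Measure ℝ) (s x : ℝ) {t : ℝ} (ht0 : 0 < t) (ht1 : t < 1) :
    densityIntegral μ s x t 1 = avgA μ s x t * (-Real.log t) := by
  have := (neg_pos.2 (Real.log_neg ht0 ht1)).ne'
  rw [avgA, ← densityIntegral, one_div, mul_comm, mul_inv_cancel_left₀ this]

lemma eventually_mem_Ioo_zero {δ : ℝ} (hδ : 0 < δ) : ∀ᶠ t : ℝ in 𝓝[>] 0, t ∈ Ioo 0 δ :=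
  Ioo_mem_nhdsGT hδ

lemma tendsto_exp_neg_natCast : Tendsto (fun n : ℕ => Real.exp (-n)) atTop (𝓝[>] 0) := by
  refine tendsto_nhdsWithin_iff.2 ⟨?_, Eventually.of_forall fun n => Real.exp_pos _⟩
  exact Real.tendsto_exp_neg_atTop_nhds_zero.comp tendsto_natCast_atTop_atTop

namespace ConformalMeasure

variable {ι : Type} {X : Set ℝ} {φ : List ι → ℝ → ℝ} {r : List ι → ℝ} {C s M : ℝ} {μ : Measure ℝ}

lemma eventually_avgA_mem_Icc (hm : ConformalMeasure X φ r C s M μ) {x : ℝ} (hx : x ∈ X) :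
    ∀ᶠ t in 𝓝[>] 0, avgA μ s x t ∈ Icc 0 M := by
  filter_upwards [eventually_mem_Ioo_zero one_pos] with t ht
  have h1 := neg_pos.2 (Real.log_neg ht.1 ht.2)
  have h2 := densityIntegral_nonneg μ s x ht.1 ht.2.le
  have h3 := hm.densityIntegral_le hx ht.1 ht.2.le
  rw [densityIntegral_eq_avgA_mul μ s x ht.1 ht.2] at h2 h3
  rw [Real.log_one, zero_sub] at h3
  exact ⟨nonneg_of_mul_nonneg_left h2 h1, le_of_mul_le_mul_right h3 h1⟩

lemma isBoundedUnder_le_avgA (hm : ConformalMeasure X φ r C s M μ) {x : ℝ} (hx : x ∈ X) :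
    IsBoundedUnder (· ≤ ·) (𝓝[>] 0) fun t => avgA μ s x t :=
  isBoundedUnder_of_eventually_le ((hm.eventually_avgA_mem_Icc hx).mono fun _ h => h.2)

lemma isBoundedUnder_ge_avgA (hm : ConformalMeasure X φ r C s M μ) {x : ℝ} (hx : x ∈ X) :
    IsBoundedUnder (· ≥ ·) (𝓝[>] 0) fun t => avgA μ s x t :=
  isBoundedUnder_of_eventually_ge ((hm.eventually_avgA_mem_Icc hx).mono fun _ h => h.1)

lemma frequently_densityIntegral_le (hm : ConformalMeasure X φ r C s M μ) {x α η : ℝ}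
    (hx : x ∈ X) (hα : lowerAvg μ s x ≤ α) (hη : 0 < η) :
    ∃ᶠ n : ℕ in atTop, densityIntegral μ s x (Real.exp (-n)) 1 ≤ (α + η) * n := by
  have h1 : ∃ᶠ t in 𝓝[>] 0, avgA μ s x t < α + η / 2 :=
    frequently_lt_of_liminf_lt (hm.isBoundedUnder_le_avgA hx).isCoboundedUnder_ge
      (hα.trans_lt (by linarith))
  refine frequently_atTop.2 fun N => ?_
  obtain ⟨K, hKN, hK⟩ : ∃ K : ℕ, N ≤ K ∧ |α + η / 2| ≤ η / 2 * K := by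
    obtain ⟨k, hk⟩ := exists_nat_ge (|α + η / 2| / (η / 2))
    refine ⟨max N k, le_max_left _ _, ?_⟩
    rw [mul_comm, ← div_le_iff₀ (half_pos hη)]
    exact hk.trans (by exact_mod_cast le_max_right N k)
  obtain ⟨t, ht, ht0, htK⟩ :=
    (h1.and_eventually (eventually_mem_Ioo_zero (Real.exp_pos (-(K + 1 : ℝ))))).exists
  have hlog : (K + 1 : ℝ) < -Real.log t := by
    have := Real.log_lt_log ht0 htK
    rw [Real.log_exp] at this
    linarith
  have hK0 : (0 : ℝ) ≤ K := K.cast_nonneg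
  have ht1 : t < 1 := by
    refine htK.trans (Real.exp_lt_one_iff.2 ?_)
    linarith
  set n := ⌊-Real.log t⌋₊ with hn
  have hn1 : (n : ℝ) ≤ -Real.log t := Nat.floor_le (by linarith)
  have hn2 : -Real.log t < n + 1 := Nat.lt_floor_add_one _
  have hKn : (K : ℝ) ≤ n := by linarith
  refine ⟨n, hKN.trans (by exact_mod_cast hKn), ?_⟩
  have htn : t ≤ Real.exp (-n) := by
    rw [← Real.log_le_iff_le_exp ht0]
    linarith
  have := hm.toIsProbabilityMeasure
  have h2 := densityIntegral_add μ s x ht0 (Real.exp_pos (-n)) one_pos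
  have h3 := densityIntegral_nonneg μ s x ht0 htn
  rw [densityIntegral_eq_avgA_mul μ s x ht0 ht1] at h2
  have h4 : avgA μ s x t * (-Real.log t) ≤ (α + η / 2) * (-Real.log t) :=
    mul_le_mul_of_nonneg_right ht.le (by linarith)
  have h5 : (α + η / 2) * (-Real.log t - n) ≤ |α + η / 2| := by
    refine (le_abs_self _).trans ?_
    rw [abs_mul]
    refine mul_le_of_le_one_right (abs_nonneg _) ?_
    rw [abs_le]
    constructor <;> linarith
  have h6 : η / 2 * K ≤ η / 2 * n := mul_le_mul_of_nonneg_left hKn (half_pos hη).le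
  linarith

lemma eventually_le_densityIntegral (hm : ConformalMeasure X φ r C s M μ) {x α : ℝ}
    (hx : x ∈ X) (hα : α < lowerAvg μ s x) :
    ∀ᶠ n : ℕ in atTop, α * n ≤ densityIntegral μ s x (Real.exp (-n)) 1 := by
  have h1 : ∀ᶠ t in 𝓝[>] 0, α < avgA μ s x t :=
    eventually_lt_of_lt_liminf hα (hm.isBoundedUnder_ge_avgA hx)
  filter_upwards [tendsto_exp_neg_natCast.eventually h1, eventually_gt_atTop 0] with n hn hn0
  have hn0 : (0 : ℝ) < n := by exact_mod_cast hn0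
  rw [densityIntegral_eq_avgA_mul μ s x (Real.exp_pos _) (Real.exp_lt_one_iff.2 (by linarith)),
    Real.log_exp, neg_neg]
  exact mul_le_mul_of_nonneg_right hn.le hn0.le

end ConformalMeasure

/-- Below the almost sure value `α₀`, the sub-level sets of the lower average density have the
same dimension as the level sets of the average density. -/
lemma ConformalSystem.dimH_subLevel_le {ι : Type} {X : Set ℝ} {φ : List ι → ℝ → ℝ}
    {r : List ι → ℝ} {C s M α α₀ : ℝ} {μ : Measure ℝ} (h : ConformalSystem X φ r C)
    (hm : ConformalMeasure X φ r C s M μ) (hXc : IsCompact X) (hXne : X.Nonempty) (hs0 : 0 < s)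
    (hs : dimH X = ENNReal.ofReal s) (hα : α ≤ α₀)
    (hμ : 1 ≤ μ {x ∈ X | upperAvg μ s x = α₀ ∧ lowerAvg μ s x = α₀}) :
    dimH {x ∈ X | lowerAvg μ s x ≤ α} ≤
      dimH {x ∈ X | upperAvg μ s x = α ∧ lowerAvg μ s x = α} := by
  have hC := h.pos
  have hsub : dimH {x ∈ X | lowerAvg μ s x ≤ α} ≤ ENNReal.ofReal s :=
    (dimH_mono (sep_subset _ _)).trans_eq hs
  refine le_of_forall_lt fun c hc => ?_
  obtain ⟨e', hce, he'⟩ := exists_between hc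
  obtain ⟨d', hed, hd'⟩ := exists_between he'
  have hdtop : d' ≠ ∞ := hd'.ne_top
  have hetop : e' ≠ ∞ := he'.ne_top
  have he0 : 0 < e'.toReal := ENNReal.toReal_pos (zero_le.trans_lt hce).ne' hetop
  have hed0 : e'.toReal < d'.toReal := (ENNReal.toReal_lt_toReal hetop hdtop).2 hed
  have hds : d'.toReal < s := by
    rw [← ENNReal.ofReal_lt_ofReal_iff hs0, ENNReal.ofReal_toReal hdtop]
    exact hd'.trans_le hsub
  refine hce.trans_le ?_
  rw [← ENNReal.ofReal_toReal hetop]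
  refine (h.le_dimH_level_set (α := α) hm hXc hXne hs0.le he0 hed0 fun η hη => ?_).trans
    (dimH_mono fun x hx => ⟨hx.1, hx.2.limsup_eq, hx.2.liminf_eq⟩)
  refine (frequently_separated_of_lt_dimH (A := {x ∈ X | lowerAvg μ s x ≤ α})
    (E := fun n : ℕ => {x ∈ X | densityIntegral μ s x (Real.exp (-n)) 1 ≤ (α + η) * n})
    (fun x hx => (hm.frequently_densityIntegral_le hx.1 hx.2 hη).mono fun n hn => ⟨hx.1, hn⟩)
    (he0.trans hed0).le ?_ (by positivity) _).and_eventually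
    (hm.eventually_separated
      (E := fun n : ℕ => {x ∈ X | (α - η) * n ≤ densityIntegral μ s x (Real.exp (-n)) 1})
      (fun n => sep_subset _ _) (fun x hx => ?_) hμ hds (by positivity) _)
  · rwa [ENNReal.ofReal_toReal hdtop]
  · refine (hm.eventually_le_densityIntegral hx.1 ?_).mono fun n hn => ⟨hx.1, hn⟩
    rw [hx.2.2]
    linarith

/-- For the natural measure on a strongly separated self-conformal set, the Hausdorff dimension
of the sub-level set `Δ̲(α) = {x : A̲(x) ≤ α}` of the lower average density equals the
multifractal spectrum `f(α)` for `α ≤ α₀` and equals `s` for `α ≥ α₀`, where `α₀` is the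
`μ`-a.s. value of the average density. -/
theorem subLevel_dimH_eq_spectrum
    {ι : Type} [Fintype ι] (g : ι → ℝ → ℝ) (hcard : 1 < Fintype.card ι)
    (hreg : ∀ i, ContDiff ℝ 1 (g i) ∧
      ∃ (ε K : ℝ≥0), 0 < ε ∧ HolderWith K ε (deriv (g i)))
    (hcontr : ∀ i, ∃ L : ℝ≥0, L < 1 ∧ LipschitzWith L (g i))
    (hder : ∀ i x, deriv (g i) x ≠ 0)
    (X : Set ℝ) (hXc : IsCompact X) (hXne : X.Nonempty)
    (hXinv : X = ⋃ i, g i '' X)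
    (hsep : Pairwise fun i j => Disjoint (g i '' X) (g j '' X))
    (s : ℝ) (hs : dimH X = ENNReal.ofReal s) (hspos : 0 < s)
    (μ : Measure ℝ) (hμ : μ = (μH[s] X)⁻¹ • (μH[s]).restrict X)
    (α₀ : ℝ) (hα₀ : ∀ᵐ x ∂μ, upperAvg μ s x = α₀ ∧ lowerAvg μ s x = α₀) :
    (∀ α : ℝ, α ≤ α₀ →
      dimH {x ∈ X | lowerAvg μ s x ≤ α} =
        dimH {x ∈ X | upperAvg μ s x = α ∧ lowerAvg μ s x = α}) ∧
    (∀ α : ℝ, α₀ ≤ α →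
      dimH {x ∈ X | lowerAvg μ s x ≤ α} = ENNReal.ofReal s) := by
  obtain ⟨φ, r, C, h⟩ := exists_conformalSystem g hreg hcontr hder hXc hXne hXinv hsep
  have h0 := h.hausdorffMeasure_ne_zero hXc hXne hs hspos
  have htop := h.hausdorffMeasure_ne_top hXc hXne hs hspos
  have hm := h.conformalMeasure hXc hspos h0 htop hμ
  have := hm.toIsProbabilityMeasure
  have hX : ∀ᵐ x ∂μ, x ∈ X := by
    rw [hμ]
    exact Measure.ae_smul_measure (ae_restrict_mem hXc.measurableSet) _
  have hA : 1 ≤ μ {x ∈ X | upperAvg μ s x = α₀ ∧ lowerAvg μ s x = α₀} :=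
    (prob_compl_eq_zero_iff₀ (NullMeasurableSet.of_compl
      (NullMeasurableSet.of_null (hX.and hα₀)))).1 (hX.and hα₀) |>.ge
  refine ⟨fun α hα => le_antisymm (h.dimH_subLevel_le hm hXc hXne hspos hs hα hA)
    (dimH_mono fun x hx => ⟨hx.1, hx.2.2.le⟩), fun α hα => le_antisymm
    ((dimH_mono (sep_subset _ _)).trans_eq hs) ?_⟩
  refine le_trans ?_ (dimH_mono (s := {x ∈ X | upperAvg μ s x = α₀ ∧ lowerAvg μ s x = α₀})
    fun x hx => ⟨hx.1, hx.2.2.trans_le hα⟩)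
  refine le_dimH_of_hausdorffMeasure_ne_zero (d := s.toNNReal) fun hzero => ?_
  rw [Real.coe_toNNReal s hspos.le] at hzero
  have hac : μ ≪ μH[s] := hμ ▸ (Measure.restrict_le_self.absolutelyContinuous).smul_left _
  rw [hac hzero] at hA
  exact not_le_of_gt one_pos hA

end
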